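/- arXiv:0911.2214 — 4 statements merged into one kernel-verified Lean document; each statement's English description precedes it below -/
import Mathlib

section
/- For every k ≥ 2 and D > 0 there exists a constant C' such that the following holds. Let U be a finite set with |U| = m, let π be a ranking of U and σ an ordering of U with |π(x) − σ(x)| ≤ D·ε·m for all x ∈ U and some ε > 0. For distinct u, v ∈ U, let N_{uv} be the number of k-subsets S with {u,v} ⊆ S ⊆ U containing a pair {s,t} ⊆ S with {s,t} ≠ {u,v} such that s and t are not in the same relative order in σ and π. Then N_{uv} ≤ C' · ε · m^{k−2}. -/
open scoped Classical

universe u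

noncomputable section

variable {α : Type u}

/-- `f` and `g` order the elements of `S` the same way. -/
def SameOrderOn (S : Finset α) (f g : α → ℝ) : Prop :=
  ∀ x ∈ S, ∀ y ∈ S, (f x < f y ↔ g x < g y)

/-- An ordering of `S` is an injection of `S` into `ℝ`. -/
def IsOrderingOn (S : Finset α) (σ : α → ℝ) : Prop :=
  Set.InjOn σ ↑S

/-- A ranking of `S` is a bijection from `S` onto `{1, …, |S|}`. -/
def IsRankingOn (S : Finset α) (π : α → ℝ) : Prop :=
  Set.BijOn π ↑S ((fun i : ℕ => (i : ℝ)) '' Set.Icc 1 S.card)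

/-- The rankings `π` and `π'` of `S` differ by the move of a single vertex:
`π' = Ranking(v ↦ p ⊕ π|_{S∖{v}})` for some `v ∈ S` and half-integer `p`,
and the two rankings differ. -/
def SingleMove (S : Finset α) (π π' : α → ℝ) : Prop :=
  ∃ v ∈ S, ∃ p : ℝ, (∃ m : ℤ, p = (m : ℝ) + 1 / 2) ∧
    SameOrderOn S π' (Function.update π v p) ∧ ∃ x ∈ S, π x ≠ π' x

/-- The rankings `π` and `π'` of `S` differ by one of the four weak single-vertex moves:
swap the first two vertices, swap the last two, or move the first or last vertex to the
other end; formally `π' = Ranking(v ↦ p ⊕ π|_{S∖{v}})` with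
`(π v, p) ∈ {(1, 2+1/2), (1, k+1/2), (k, k−3/2), (k, 1/2)}` where `k = |S|`. -/
def WeakMove (S : Finset α) (π π' : α → ℝ) : Prop :=
  ∃ v ∈ S, ∃ p : ℝ,
    ((π v = 1 ∧ p = 2 + 1 / 2) ∨ (π v = 1 ∧ p = (S.card : ℝ) + 1 / 2) ∨
      (π v = (S.card : ℝ) ∧ p = (S.card : ℝ) - 3 / 2) ∨
      (π v = (S.card : ℝ) ∧ p = 1 / 2)) ∧
    SameOrderOn S π' (Function.update π v p) ∧ ∃ x ∈ S, π x ≠ π' x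

/-- A constraint `c` on `S` is fragile if any two rankings of `S` differing by the move of
a single vertex satisfy `c π + c π' ≥ 1`. -/
def FragileOn (S : Finset α) (c : (α → ℝ) → ℕ) : Prop :=
  ∀ π π' : α → ℝ, IsRankingOn S π → IsRankingOn S π' → SingleMove S π π' → 1 ≤ c π + c π'

/-- A constraint `c` on `S` is weakly fragile if any two rankings of `S` differing by one of
the four weak moves satisfy `c π + c π' ≥ 1`. -/
def WeaklyFragileOn (S : Finset α) (c : (α → ℝ) → ℕ) : Prop :=
  ∀ π π' : α → ℝ, IsRankingOn S π → IsRankingOn S π' → WeakMove S π π' → 1 ≤ c π + c π'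

/-- A (fully dense) arity-`k` constraint system on `U`: to every `k`-subset `S` of `U` it
assigns a `{0,1}`-valued cost `c S` which depends only on the relative order of its
argument on `S` (so `c S σ` is the cost of the ranking of `S` induced by `σ`). -/
def IsConstraintSystem (U : Finset α) (k : ℕ) (c : Finset α → (α → ℝ) → ℕ) : Prop :=
  ∀ S ∈ U.powersetCard k,
    (∀ σ : α → ℝ, c S σ ≤ 1) ∧ ∀ σ σ' : α → ℝ, SameOrderOn S σ σ' → c S σ = c S σ'

/-- Every constraint of the system is weakly fragile. -/
def WeaklyFragileSystem (U : Finset α) (k : ℕ) (c : Finset α → (α → ℝ) → ℕ) : Prop :=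
  ∀ S ∈ U.powersetCard k, WeaklyFragileOn S (c S)

/-- The cost `C^c(σ) = Σ_{S ⊆ U, |S| = k} c(σ|_S)` of an ordering `σ`. -/
def cost (U : Finset α) (k : ℕ) (c : Finset α → (α → ℝ) → ℕ) (σ : α → ℝ) : ℕ :=
  ∑ S ∈ U.powersetCard k, c S σ

/-- `b^c(σ, v, p) = Σ_{Q ⊆ U∖{v}, |Q| = k−1} c(σ|_Q ⊕ v ↦ p)`: the cost of the
constraints involving `v` after moving `v` to position `p` (here `U` is the domain of `σ`). -/
def bcost (U : Finset α) (k : ℕ) (c : Finset α → (α → ℝ) → ℕ) (σ : α → ℝ) (v : α) (p : ℝ) : ℕ :=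
  ∑ Q ∈ (U.erase v).powersetCard (k - 1), c (insert v Q) (Function.update σ v p)

/-- The rank of `x` within `S` under the ordering `σ`. -/
def rk (S : Finset α) (σ : α → ℝ) (x : α) : ℕ :=
  (S.filter fun y => σ y ≤ σ x).card

/-- The ordering of `S` obtained from `σ` by moving `v` to a position immediately
before `u` (all other vertices of `S` keeping their relative order). -/
def moveBefore (S : Finset α) (σ : α → ℝ) (v u : α) : α → ℝ :=
  Function.update (fun x => (rk S σ x : ℝ)) v ((rk S σ u : ℝ) - 1 / 2)

/-- The feedback-arc-set weight `w^σ_{uv}`: the number of `k`-subsets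
`{u,v} ⊆ S ⊆ U` with `c(σ') = 1`, where `σ' = σ|_{S∖{v}} ⊕ v ↦ p` and `p` places `v`
immediately before `u` if `σ v > σ u`, and `p = σ v` otherwise. -/
def wgt (U : Finset α) (k : ℕ) (c : Finset α → (α → ℝ) → ℕ) (σ : α → ℝ) (u v : α) : ℕ :=
  ((U.powersetCard k).filter fun S =>
    u ∈ S ∧ v ∈ S ∧ if σ u < σ v then c S (moveBefore S σ v u) = 1 else c S σ = 1).card

/-- The canceled weights
`w̄^σ_{uv} = w^σ_{uv} − min((1/(10·3^{k−1}))·C(|U|−2, k−2), w^σ_{uv}, w^σ_{vu})`. -/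
def wbar (U : Finset α) (k : ℕ) (c : Finset α → (α → ℝ) → ℕ) (σ : α → ℝ) (u v : α) : ℝ :=
  (wgt U k c σ u v : ℝ) -
    min (1 / (10 * 3 ^ (k - 1)) * ((U.card - 2).choose (k - 2) : ℝ))
      (min (wgt U k c σ u v : ℝ) (wgt U k c σ v u : ℝ))

/-- The feedback-arc-set cost `C^w(σ) = Σ_{u,v ∈ U : σ(u) > σ(v)} w_{uv}`. -/
def costW (U : Finset α) (w : α → α → ℝ) (σ : α → ℝ) : ℝ :=
  ∑ x ∈ U, ∑ y ∈ U, if σ y < σ x then w x y else 0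

/-- `b^w(σ, v, p) = Σ_{u ≠ v} (w_{uv} if σ(u) > p, w_{vu} if σ(u) < p)`. -/
def bW (U : Finset α) (w : α → α → ℝ) (σ : α → ℝ) (v : α) (p : ℝ) : ℝ :=
  ∑ x ∈ U.erase v, if p < σ x then w x v else if σ x < p then w v x else 0

/-- The Kendall tau distance: the number of `σ/σ'`-inversions, i.e. of unordered pairs
`{u,v} ⊆ S` on which `σ` and `σ'` disagree. -/
def kendall (S : Finset α) (σ σ' : α → ℝ) : ℕ :=
  ((S ×ˢ S).filter fun q => σ q.1 < σ q.2 ∧ σ' q.2 < σ' q.1).card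

/-- `Round(π)`: each position is rounded down to the nearest multiple of `e = εn`, with
ties broken by adding `u/(n+1)`. -/
def roundOrd (n e : ℕ) (π : ℕ → ℝ) : ℕ → ℝ :=
  fun u => (e : ℝ) * (⌊π u / (e : ℝ)⌋ : ℝ) + (u : ℝ) / ((n : ℝ) + 1)

end

/-- The `k`-subsets of `U` that contain `T`. -/
noncomputable def supersetsIn {α : Type u} (U : Finset α) (k : ℕ) (T : Finset α) : Finset (Finset α) :=
  (U.powersetCard k).filter fun S => T ⊆ S

/-- The elements of `U` other than `s` whose `π`-value is within `r` of that of `s`. -/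
noncomputable def nearby {α : Type u} (U : Finset α) (π : α → ℝ) (r : ℝ) (s : α) : Finset α :=
  U.filter fun t => t ≠ s ∧ |π t - π s| ≤ r

theorem card_supersetsIn_le {α : Type u} (U : Finset α) (k : ℕ) (T : Finset α) :
    (supersetsIn U k T).card ≤ U.card ^ (k - T.card) := by
  refine le_trans ?_ (Nat.choose_le_pow U.card (k - T.card))
  rw [← Finset.card_powersetCard]
  refine Finset.card_le_card_of_injOn (fun S => S \ T) ?_ ?_
  · intro S hS
    simp only [supersetsIn, Finset.coe_filter, Finset.mem_powersetCard, Set.mem_ofPred_eq] at hS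
    simp only [Finset.mem_coe, Finset.mem_powersetCard]
    exact ⟨Finset.sdiff_subset.trans hS.1.1, by rw [Finset.card_sdiff_of_subset hS.2, hS.1.2]⟩
  · intro S hS S' hS' h
    simp only [supersetsIn, Finset.coe_filter, Set.mem_ofPred_eq] at hS hS'
    rw [← Finset.sdiff_union_of_subset hS.2, ← Finset.sdiff_union_of_subset hS'.2]
    exact congrArg (· ∪ T) h

theorem card_supersetsIn_mul_pow_le {α : Type u} (U : Finset α) (k : ℕ) (T : Finset α)
    (hT : 2 ≤ T.card) :
    (supersetsIn U k T).card * U.card ^ (T.card - 2) ≤ U.card ^ (k - 2) := by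
  by_cases h : T.card ≤ k
  · calc (supersetsIn U k T).card * U.card ^ (T.card - 2)
        ≤ U.card ^ (k - T.card) * U.card ^ (T.card - 2) :=
          Nat.mul_le_mul_right _ (card_supersetsIn_le U k T)
      _ = U.card ^ (k - 2) := by rw [← pow_add]; congr 1; omega
  · have : supersetsIn U k T = ∅ := by
      refine Finset.filter_eq_empty_iff.2 fun S hS hTS => h ?_
      rw [← (Finset.mem_powersetCard.1 hS).2]
      exact Finset.card_le_card hTS
    simp [this]

theorem card_nearby_le {α : Type u} {U : Finset α} {π : α → ℝ} (hπ : IsRankingOn U π)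
    {r : ℝ} (hr : 0 ≤ r) {s : α} (hs : s ∈ U) : ((nearby U π r s).card : ℝ) ≤ 2 * r := by
  have hint : ∀ x ∈ U, ((⌊π x⌋ : ℤ) : ℝ) = π x := by
    intro x hx
    obtain ⟨n, -, hn⟩ := hπ.mapsTo hx
    simp only at hn
    simp [← hn]
  have hcard : (nearby U π r s).card ≤
      ((Finset.Icc (⌊π s⌋ - ⌊r⌋) (⌊π s⌋ + ⌊r⌋)).erase ⌊π s⌋).card := by
    refine Finset.card_le_card_of_injOn (fun x => ⌊π x⌋) ?_ ?_
    · intro t ht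
      simp only [nearby, Finset.coe_filter, Set.mem_ofPred_eq] at ht
      obtain ⟨htU, hts, hd⟩ := ht
      have hd' : |⌊π t⌋ - ⌊π s⌋| ≤ ⌊r⌋ := by
        rw [Int.le_floor]
        push_cast
        rwa [hint t htU, hint s hs]
      rw [abs_le] at hd'
      simp only [Finset.mem_coe, Finset.mem_erase, Finset.mem_Icc]
      refine ⟨fun h => hts (hπ.injOn htU hs ?_), by linarith, by linarith⟩
      rw [← hint t htU, ← hint s hs, h]
    · intro x hx y hy h
      simp only [nearby, Finset.coe_filter, Set.mem_ofPred_eq] at hx hy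
      refine hπ.injOn hx.1 hy.1 ?_
      rw [← hint x hx.1, ← hint y hy.1]
      exact congrArg _ h
  have hfl : 0 ≤ ⌊r⌋ := Int.floor_nonneg.2 hr
  rw [Finset.card_erase_of_mem (by simp [hfl]), Int.card_Icc] at hcard
  have hz : ((nearby U π r s).card : ℤ) ≤ 2 * ⌊r⌋ := by omega
  calc ((nearby U π r s).card : ℝ) ≤ 2 * (⌊r⌋ : ℝ) := by exact_mod_cast hz
    _ ≤ 2 * r := by linarith [Int.floor_le r]

theorem abs_sub_le_of_inversion {a b c d r : ℝ} (hac : |a - c| ≤ r) (hbd : |b - d| ≤ r)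
    (h : (c < d ∧ b < a) ∨ (d < c ∧ a < b)) : |a - b| ≤ 2 * r := by
  rw [abs_le] at *
  rcases h with h | h <;> constructor <;> linarith

/-- The sets containing `u`, `v` and a further pair of nearby elements are covered by the
supersets of `{u, v, t}` with `t` near `u` or `v`, and of `{u, v, s, t}` with `t` near `s`. -/
theorem mem_cover_of_nearby {α : Type u} {U S : Finset α} {k : ℕ} {π : α → ℝ} {r : ℝ}
    {u v s t : α} (hS : S ∈ U.powersetCard k) (hu : u ∈ S) (hv : v ∈ S) (hs : s ∈ S) (ht : t ∈ S)
    (hst : s ≠ t) (hne : ({s, t} : Finset α) ≠ {u, v}) (hd : |π s - π t| ≤ r) :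
    S ∈ ((nearby U π r u \ {u, v}).biUnion fun t => supersetsIn U k {u, v, t}) ∪
      (((nearby U π r v \ {u, v}).biUnion fun t => supersetsIn U k {u, v, t}) ∪
        ((U \ {u, v}).biUnion fun s =>
          (nearby U π r s \ {u, v}).biUnion fun t => supersetsIn U k {u, v, s, t})) := by
  have hSU := (Finset.mem_powersetCard.1 hS).1
  have hd' : |π t - π s| ≤ r := by rwa [abs_sub_comm]
  have hsU := hSU hs
  have htU := hSU ht
  simp only [Finset.mem_union, Finset.mem_biUnion, Finset.mem_sdiff, nearby, supersetsIn,
    Finset.mem_filter, Finset.mem_insert, Finset.mem_singleton, Finset.insert_subset_iff,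
    Finset.singleton_subset_iff]
  by_cases hsu : s = u
  · subst hsu
    have htv : t ≠ v := by rintro rfl; exact hne rfl
    exact Or.inl ⟨t, by tauto, hS, hu, hv, ht⟩
  by_cases hsv : s = v
  · subst hsv
    have htu : t ≠ u := by rintro rfl; exact hne (Finset.pair_comm _ _)
    exact Or.inr (Or.inl ⟨t, by tauto, hS, hu, hv, ht⟩)
  by_cases htu : t = u
  · subst htu
    exact Or.inl ⟨s, by tauto, hS, hu, hv, hs⟩
  by_cases htv : t = v
  · subst htv
    exact Or.inr (Or.inl ⟨s, by tauto, hS, hu, hv, hs⟩)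
  exact Or.inr (Or.inr ⟨s, by tauto, t, by tauto, hS, hu, hv, hs, ht⟩)

theorem card_biUnion_nearby_triple_le {α : Type u} {U : Finset α} {π : α → ℝ}
    (hπ : IsRankingOn U π) (k : ℕ) {ρ : ℝ} (hρ : 0 ≤ ρ) {u v w : α} (hw : w ∈ U) (huv : u ≠ v) :
    ((((nearby U π (ρ * U.card) w \ {u, v}).biUnion
      fun t => supersetsIn U k {u, v, t}).card : ℕ) : ℝ) ≤ 2 * ρ * (U.card : ℝ) ^ (k - 2) := by
  have hm : (0 : ℝ) < U.card := by exact_mod_cast Finset.card_pos.2 ⟨w, hw⟩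
  have hB := card_nearby_le hπ (r := ρ * U.card) (by positivity) hw
  have hB' : ((nearby U π (ρ * U.card) w \ {u, v}).card : ℝ) ≤ 2 * (ρ * U.card) :=
    le_trans (by exact_mod_cast Finset.card_le_card Finset.sdiff_subset) hB
  have hT : ∀ t ∈ nearby U π (ρ * U.card) w \ {u, v},
      ((supersetsIn U k {u, v, t}).card : ℝ) ≤ (U.card : ℝ) ^ (k - 2) / U.card := by
    intro t ht
    simp only [Finset.mem_sdiff, Finset.mem_insert, Finset.mem_singleton, not_or] at ht
    have hc : ({u, v, t} : Finset α).card = 3 :=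
      Finset.card_eq_three.2 ⟨u, v, t, huv, Ne.symm ht.2.1, Ne.symm ht.2.2, rfl⟩
    have h := card_supersetsIn_mul_pow_le U k {u, v, t} (by omega)
    rw [hc] at h
    rw [le_div_iff₀ hm]
    simpa using (by exact_mod_cast h :
      ((supersetsIn U k {u, v, t}).card : ℝ) * (U.card : ℝ) ^ (3 - 2) ≤ (U.card : ℝ) ^ (k - 2))
  calc _ ≤ ∑ t ∈ nearby U π (ρ * U.card) w \ {u, v}, ((supersetsIn U k {u, v, t}).card : ℝ) := by
        exact_mod_cast Finset.card_biUnion_le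
    _ ≤ (nearby U π (ρ * U.card) w \ {u, v}).card * ((U.card : ℝ) ^ (k - 2) / U.card) := by
        simpa using Finset.sum_le_sum hT
    _ ≤ 2 * (ρ * U.card) * ((U.card : ℝ) ^ (k - 2) / U.card) := by gcongr
    _ = 2 * ρ * (U.card : ℝ) ^ (k - 2) := by field_simp

theorem card_biUnion_nearby_quadruple_le {α : Type u} {U : Finset α} {π : α → ℝ}
    (hπ : IsRankingOn U π) (k : ℕ) {ρ : ℝ} (hρ : 0 ≤ ρ) {u v : α} (hu : u ∈ U) (huv : u ≠ v) :
    ((((U \ {u, v}).biUnion fun s => (nearby U π (ρ * U.card) s \ {u, v}).biUnion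
      fun t => supersetsIn U k {u, v, s, t}).card : ℕ) : ℝ) ≤
        2 * ρ * (U.card : ℝ) ^ (k - 2) := by
  have hm : (0 : ℝ) < U.card := by exact_mod_cast Finset.card_pos.2 ⟨u, hu⟩
  have hT : ∀ s ∈ U \ {u, v}, ∀ t ∈ nearby U π (ρ * U.card) s \ {u, v},
      ((supersetsIn U k {u, v, s, t}).card : ℝ) ≤ (U.card : ℝ) ^ (k - 2) / (U.card : ℝ) ^ 2 := by
    intro s hs t ht
    simp only [nearby, Finset.mem_filter, Finset.mem_sdiff, Finset.mem_insert,
      Finset.mem_singleton, not_or] at hs ht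
    have hc : ({u, v, s, t} : Finset α).card = 4 :=
      Finset.card_eq_of_equiv_fin (Fintype.equivFinOfCardEq (by
        rw [Fintype.card_coe, Finset.card_insert_of_notMem, Finset.card_insert_of_notMem,
          Finset.card_pair (Ne.symm ht.1.2.1)]
        · simp only [Finset.mem_insert, Finset.mem_singleton, not_or]
          exact ⟨Ne.symm hs.2.2, Ne.symm ht.2.2⟩
        · simp only [Finset.mem_insert, Finset.mem_singleton, not_or]
          exact ⟨huv, Ne.symm hs.2.1, Ne.symm ht.2.1⟩))
    have h := card_supersetsIn_mul_pow_le U k {u, v, s, t} (by omega)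
    rw [hc] at h
    rw [le_div_iff₀ (by positivity)]
    exact_mod_cast h
  have hin : ∀ s ∈ U \ {u, v}, ((((nearby U π (ρ * U.card) s \ {u, v}).biUnion
      fun t => supersetsIn U k {u, v, s, t}).card : ℕ) : ℝ) ≤
        2 * (ρ * U.card) * ((U.card : ℝ) ^ (k - 2) / (U.card : ℝ) ^ 2) := by
    intro s hs
    have hB := card_nearby_le hπ (r := ρ * U.card) (by positivity) (Finset.mem_sdiff.1 hs).1
    have hB' : ((nearby U π (ρ * U.card) s \ {u, v}).card : ℝ) ≤ 2 * (ρ * U.card) :=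
      le_trans (by exact_mod_cast Finset.card_le_card Finset.sdiff_subset) hB
    calc _ ≤ ∑ t ∈ nearby U π (ρ * U.card) s \ {u, v},
            ((supersetsIn U k {u, v, s, t}).card : ℝ) := by
          exact_mod_cast Finset.card_biUnion_le
      _ ≤ (nearby U π (ρ * U.card) s \ {u, v}).card *
            ((U.card : ℝ) ^ (k - 2) / (U.card : ℝ) ^ 2) := by
          simpa using Finset.sum_le_sum (hT s hs)
      _ ≤ _ := by gcongr
  have hU : ((U \ {u, v}).card : ℝ) ≤ U.card := by
    exact_mod_cast Finset.card_le_card Finset.sdiff_subset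
  calc _ ≤ ∑ s ∈ U \ {u, v}, ((((nearby U π (ρ * U.card) s \ {u, v}).biUnion
            fun t => supersetsIn U k {u, v, s, t}).card : ℕ) : ℝ) := by
        exact_mod_cast Finset.card_biUnion_le
    _ ≤ (U \ {u, v}).card *
          (2 * (ρ * U.card) * ((U.card : ℝ) ^ (k - 2) / (U.card : ℝ) ^ 2)) := by
        simpa using Finset.sum_le_sum hin
    _ ≤ U.card * (2 * (ρ * U.card) * ((U.card : ℝ) ^ (k - 2) / (U.card : ℝ) ^ 2)) := by gcongr
    _ = 2 * ρ * (U.card : ℝ) ^ (k - 2) := by field_simp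

/-- if the ranking `π` and the ordering `σ` of `U` (`|U| = m`) satisfy
`|π(x) − σ(x)| ≤ D·ε·m` for all `x`, then for distinct `u, v ∈ U` the number `N_{uv}` of
`k`-subsets `{u,v} ⊆ S ⊆ U` containing a pair `{s,t} ≠ {u,v}` ordered differently by `σ`
and `π` is at most `C'·ε·m^{k−2}`, for a constant `C' = C'(k, D)`. -/
theorem footrule_inversion_bound (k : ℕ) (hk : 2 ≤ k) (D : ℝ) (hD : 0 < D) :
    ∃ C' : ℝ, ∀ (α : Type u) (U : Finset α) (m : ℕ), U.card = m →
      ∀ (π σ : α → ℝ), IsRankingOn U π → IsOrderingOn U σ →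
      ∀ ε : ℝ, 0 < ε → (∀ x ∈ U, |π x - σ x| ≤ D * ε * (m : ℝ)) →
      ∀ u ∈ U, ∀ v ∈ U, u ≠ v →
        (((U.powersetCard k).filter fun S => u ∈ S ∧ v ∈ S ∧
            ∃ s ∈ S, ∃ t ∈ S, s ≠ t ∧ ({s, t} : Finset α) ≠ ({u, v} : Finset α) ∧
              ((σ s < σ t ∧ π t < π s) ∨ (σ t < σ s ∧ π s < π t))).card : ℝ) ≤
          C' * ε * (m : ℝ) ^ (k - 2) := by
  refine ⟨12 * D, ?_⟩
  rintro α U m rfl π σ hπ - ε hε hclose u hu v hv huv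
  have hρ : 0 ≤ 2 * (D * ε) := by positivity
  have hu3 := card_biUnion_nearby_triple_le hπ k hρ hu huv
  have hv3 := card_biUnion_nearby_triple_le hπ k hρ hv huv
  have h4 := card_biUnion_nearby_quadruple_le hπ k hρ hu huv
  have hcover := Finset.card_le_card fun S
      (hS : S ∈ (U.powersetCard k).filter fun S => u ∈ S ∧ v ∈ S ∧
        ∃ s ∈ S, ∃ t ∈ S, s ≠ t ∧ ({s, t} : Finset α) ≠ ({u, v} : Finset α) ∧
          ((σ s < σ t ∧ π t < π s) ∨ (σ t < σ s ∧ π s < π t))) => by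
    obtain ⟨hS, huS, hvS, s, hs, t, ht, hst, hne, hinv⟩ := Finset.mem_filter.1 hS
    have hSU := (Finset.mem_powersetCard.1 hS).1
    refine mem_cover_of_nearby hS huS hvS hs ht hst hne (π := π) (r := 2 * (D * ε) * U.card) ?_
    rw [mul_assoc]
    exact abs_sub_le_of_inversion (hclose s (hSU hs)) (hclose t (hSU ht)) hinv
  have hunion := hcover.trans ((Finset.card_union_le _ _).trans
    (Nat.add_le_add_left (Finset.card_union_le _ _) _))
  refine (Nat.cast_le (α := ℝ).2 hunion).trans ?_
  push_cast
  linarith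
end

section
/- For every k ≥ 2 and D > 0 there exists a constant C' such that the following holds. Let c be an arity-k constraint system on a finite set U with |U| = m, let π be a ranking of U and σ an ordering of U with |π(x) − σ(x)| ≤ D·ε·m for all x ∈ U and some ε > 0. Then for all distinct u, v ∈ U: w^σ_{uv} ≤ w^π_{uv} + C' · ε · m^{k−2}. -/
open scoped Classical

universe u

theorem rk_lt_rk_iff {α : Type u} {S : Finset α} (σ : α → ℝ) {x y : α} (hy : y ∈ S) :
    rk S σ x < rk S σ y ↔ σ x < σ y := by
  constructor
  · intro h
    by_contra hxy
    refine absurd h (not_lt.mpr (Finset.card_le_card fun z hz => ?_))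
    rw [Finset.mem_filter] at hz ⊢
    exact ⟨hz.1, hz.2.trans (not_lt.mp hxy)⟩
  · intro h
    refine Finset.card_lt_card (Finset.ssubset_iff_subset_ne.mpr ⟨fun z hz => ?_, fun he => ?_⟩)
    · rw [Finset.mem_filter] at hz ⊢
      exact ⟨hz.1, hz.2.trans h.le⟩
    · have : y ∈ S.filter fun z => σ z ≤ σ x := by
        rw [he]
        exact Finset.mem_filter.mpr ⟨hy, le_rfl⟩
      exact absurd (Finset.mem_filter.mp this).2 (not_le.mpr h)

/-- The ordering that determines whether `S` contributes to `wgt U k c σ u v`. -/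
noncomputable def wgtOrd {α : Type u} (S : Finset α) (σ : α → ℝ) (u v : α) : α → ℝ :=
  if σ u < σ v then moveBefore S σ v u else σ

theorem moveBefore_lt_iff {α : Type u} {S : Finset α} (σ : α → ℝ) {u v : α} (hu : u ∈ S)
    {x y : α} (hy : y ∈ S) :
    moveBefore S σ v u x < moveBefore S σ v u y ↔
      (x ≠ v ∧ y ≠ v ∧ σ x < σ y) ∨ (x ≠ v ∧ y = v ∧ σ x < σ u) ∨
        (x = v ∧ y ≠ v ∧ σ u ≤ σ y) := by
  unfold moveBefore
  by_cases hxv : x = v <;> by_cases hyv : y = v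
  · simp [hxv, hyv]
  · subst hxv
    simp only [Function.update_self, Function.update_of_ne hyv]
    have := (rk_lt_rk_iff σ hu (x := y)).not
    rw [not_lt, not_lt] at this
    simp only [ne_eq, not_true_eq_false, hyv, not_false_eq_true, false_and, true_and, false_or]
    rw [← this]
    constructor
    · intro h
      have : (rk S σ u : ℝ) < (rk S σ y : ℝ) + 1 := by linarith
      exact Nat.lt_succ_iff.mp (by exact_mod_cast this)
    · intro h
      have : (rk S σ u : ℝ) ≤ rk S σ y := by exact_mod_cast h
      linarith
  · subst hyv
    simp only [Function.update_self, Function.update_of_ne hxv]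
    simp only [ne_eq, hxv, not_false_eq_true, not_true_eq_false, false_and, and_false, true_and,
      false_or, or_false]
    rw [← rk_lt_rk_iff σ hu]
    constructor
    · intro h
      have : (rk S σ x : ℝ) < rk S σ u := by linarith
      exact_mod_cast this
    · intro h
      have : (rk S σ x : ℝ) + 1 ≤ rk S σ u := by exact_mod_cast h
      linarith
  · simp only [Function.update_of_ne hxv, Function.update_of_ne hyv]
    simp [hxv, hyv, rk_lt_rk_iff σ hy]

theorem wgtOrd_lt_iff {α : Type u} {S : Finset α} {σ : α → ℝ} (hσ : Set.InjOn σ ↑S) {u v : α}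
    (hu : u ∈ S) (hv : v ∈ S) {x y : α} (hy : y ∈ S) :
    wgtOrd S σ u v x < wgtOrd S σ u v y ↔
      (x ≠ v ∧ y ≠ v ∧ σ x < σ y) ∨ (x ≠ v ∧ y = v ∧ σ x < σ u ∧ σ x < σ v) ∨
        (x = v ∧ y ≠ v ∧ (y = u ∨ σ u < σ y ∨ σ v < σ y)) := by
  have huy : σ u ≤ σ y ↔ y = u ∨ σ u < σ y := by
    rw [le_iff_eq_or_lt]
    exact or_congr_left ⟨fun h => (hσ hu hy h).symm, fun h => by rw [h]⟩
  have hvu : σ u = σ v → u = v := fun h => hσ hu hv h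
  unfold wgtOrd
  split_ifs with h
  · rw [moveBefore_lt_iff σ hu hy, huy]
    grind
  · grind

theorem sameOrderOn_wgtOrd {α : Type u} {S : Finset α} {π σ : α → ℝ} (hπ : Set.InjOn π ↑S)
    (hσ : Set.InjOn σ ↑S) {u v : α} (hu : u ∈ S) (hv : v ∈ S)
    (h : ∀ x ∈ S, x ≠ u → x ≠ v → ∀ y ∈ S, x ≠ y →
      ((π x < π y ↔ σ x < σ y) ∧ (π y < π x ↔ σ y < σ x))) :
    SameOrderOn S (wgtOrd S σ u v) (wgtOrd S π u v) := by
  intro x hx y hy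
  rw [wgtOrd_lt_iff hσ hu hv hy, wgtOrd_lt_iff hπ hu hv hy]
  by_cases x = u <;> by_cases x = v <;> by_cases y = u <;> by_cases y = v <;> by_cases x = y <;>
    grind

theorem lt_iff_lt_of_abs_sub_le {a b a' b' t : ℝ} (ha : |a - a'| ≤ t) (hb : |b - b'| ≤ t)
    (h : 2 * t < |a - b|) : (a < b ↔ a' < b') ∧ (b < a ↔ b' < a') := by
  rw [abs_le] at ha hb
  rcases lt_abs.mp h with h | h <;> grind

theorem card_close_le {α : Type u} {U : Finset α} {π : α → ℝ} (hπ : IsRankingOn U π) {t : ℝ}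
    (ht : 0 ≤ t) {y : α} (hy : y ∈ U) :
    ((U.filter fun x => x ≠ y ∧ |π x - π y| ≤ t).card : ℝ) ≤ 2 * t := by
  have key : (U.filter fun x => x ≠ y ∧ |π x - π y| ≤ t).card ≤
      ((Finset.Icc (-(⌊t⌋)) ⌊t⌋).erase 0).card := by
    have hint : ∀ x ∈ U, (⌊π x⌋ : ℝ) = π x := by
      intro x hx
      obtain ⟨i, -, hi⟩ := hπ.mapsTo hx
      simp only [← hi, Int.floor_natCast, Int.cast_natCast]
    refine Finset.card_le_card_of_injOn (fun x => ⌊π x⌋ - ⌊π y⌋) ?_ ?_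
    · intro x hx
      obtain ⟨hxU, hxy, hle⟩ := Finset.mem_filter.mp hx
      rw [← hint x hxU, ← hint y hy, abs_le] at hle
      rw [Finset.mem_coe, Finset.mem_erase, Finset.mem_Icc]
      refine ⟨fun h0 => hxy (hπ.injOn hxU hy ?_), ?_, ?_⟩
      · rw [← hint x hxU, ← hint y hy, sub_eq_zero.mp h0]
      · rw [neg_le]
        exact Int.le_floor.mpr (by push_cast; linarith)
      · exact Int.le_floor.mpr (by push_cast; linarith)
    · intro x hx z hz hxz
      have hxU := (Finset.mem_filter.mp hx).1
      have hzU := (Finset.mem_filter.mp hz).1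
      refine hπ.injOn hxU hzU ?_
      rw [← hint x hxU, ← hint z hzU, sub_left_inj.mp hxz]
  have h0 : 0 ≤ ⌊t⌋ := Int.floor_nonneg.mpr ht
  have hcard : (((Finset.Icc (-(⌊t⌋)) ⌊t⌋).erase 0).card : ℤ) = 2 * ⌊t⌋ := by
    rw [Finset.card_erase_of_mem (Finset.mem_Icc.mpr ⟨by omega, h0⟩), Int.card_Icc]
    omega
  have hle : ((U.filter fun x => x ≠ y ∧ |π x - π y| ≤ t).card : ℤ) ≤ 2 * ⌊t⌋ := by
    rw [← hcard]
    exact_mod_cast key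
  have hle' : ((U.filter fun x => x ≠ y ∧ |π x - π y| ≤ t).card : ℝ) ≤ 2 * (⌊t⌋ : ℝ) := by
    exact_mod_cast hle
  linarith [Int.floor_le t]

theorem card_supersets_mul_le {α : Type u} (U T : Finset α) (k : ℕ) :
    ((U.powersetCard k).filter fun S => T ⊆ S).card * U.card ^ T.card ≤ U.card ^ k := by
  rcases ((U.powersetCard k).filter fun S => T ⊆ S).eq_empty_or_nonempty with h | ⟨S₀, h₀⟩
  · simp [h]
  have hk : T.card ≤ k := by
    obtain ⟨h₁, h₂⟩ := Finset.mem_filter.mp h₀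
    exact (Finset.card_le_card h₂).trans_eq (Finset.mem_powersetCard.mp h₁).2
  have hle : ((U.powersetCard k).filter fun S => T ⊆ S).card ≤ U.card ^ (k - T.card) := by
    refine le_trans ?_ (Nat.choose_le_pow U.card (k - T.card))
    rw [← Finset.card_powersetCard]
    refine Finset.card_le_card_of_injOn (fun S => S \ T) ?_ ?_
    · intro S hS
      obtain ⟨h₁, h₂⟩ := Finset.mem_filter.mp hS
      obtain ⟨h₃, h₄⟩ := Finset.mem_powersetCard.mp h₁
      rw [Finset.mem_coe, Finset.mem_powersetCard]
      exact ⟨Finset.sdiff_subset.trans h₃, by rw [Finset.card_sdiff_of_subset h₂, h₄]⟩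
    · intro S hS S' hS' he
      have h₁ := (Finset.mem_filter.mp hS).2
      have h₂ := (Finset.mem_filter.mp hS').2
      rw [← Finset.sdiff_union_of_subset h₁, ← Finset.sdiff_union_of_subset h₂]
      exact congrArg (· ∪ T) he
  calc _ ≤ U.card ^ (k - T.card) * U.card ^ T.card := Nat.mul_le_mul_right _ hle
    _ = U.card ^ k := by rw [← pow_add, Nat.sub_add_cancel hk]

/-- The number of `k`-subsets of `U` that contain one of the `n`-sets `f i`, `i ∈ I`. -/
theorem card_biUnion_supersets_mul_le {α ι : Type*} (U : Finset α) (k n : ℕ) (I : Finset ι)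
    (f : ι → Finset α) (hf : ∀ i ∈ I, (f i).card = n) :
    (I.biUnion fun i => (U.powersetCard k).filter fun S => f i ⊆ S).card * U.card ^ n ≤
      I.card * U.card ^ k := by
  calc _ ≤ (∑ i ∈ I, ((U.powersetCard k).filter fun S => f i ⊆ S).card) * U.card ^ n :=
        Nat.mul_le_mul_right _ Finset.card_biUnion_le
    _ = ∑ i ∈ I, ((U.powersetCard k).filter fun S => f i ⊆ S).card * U.card ^ n :=
        Finset.sum_mul ..
    _ ≤ ∑ _i ∈ I, U.card ^ k := Finset.sum_le_sum fun i hi => by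
        rw [← hf i hi]
        exact card_supersets_mul_le U (f i) k
    _ = _ := by rw [Finset.sum_const, smul_eq_mul]

theorem wgt_eq_card_wgtOrd {α : Type u} (U : Finset α) (k : ℕ) (c : Finset α → (α → ℝ) → ℕ)
    (σ : α → ℝ) (u v : α) :
    wgt U k c σ u v = ((U.powersetCard k).filter fun S =>
      u ∈ S ∧ v ∈ S ∧ c S (wgtOrd S σ u v) = 1).card := by
  unfold wgt wgtOrd
  refine congrArg Finset.card (Finset.filter_congr fun S _ => ?_)
  split_ifs <;> rfl

/-- if the ranking `π` and the ordering `σ` of `U` (`|U| = m`) satisfy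
`|π(x) − σ(x)| ≤ D·ε·m` for all `x`, then `w^σ_{uv} ≤ w^π_{uv} + C'·ε·m^{k−2}` for all
distinct `u, v ∈ U`, for a constant `C' = C'(k, D)`. -/
theorem wgt_close_additive (k : ℕ) (hk : 2 ≤ k) (D : ℝ) (hD : 0 < D) :
    ∃ C' : ℝ, ∀ (α : Type u) (U : Finset α) (m : ℕ), U.card = m →
      ∀ c : Finset α → (α → ℝ) → ℕ, IsConstraintSystem U k c →
      ∀ (π σ : α → ℝ), IsRankingOn U π → IsOrderingOn U σ →
      ∀ ε : ℝ, 0 < ε → (∀ x ∈ U, |π x - σ x| ≤ D * ε * (m : ℝ)) →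
      ∀ u ∈ U, ∀ v ∈ U, u ≠ v →
        (wgt U k c σ u v : ℝ) ≤ (wgt U k c π u v : ℝ) + C' * ε * (m : ℝ) ^ (k - 2) := by
  refine ⟨12 * D, fun α U m hm c hc π σ hπ hσ ε hε hclose u hu v hv huv => ?_⟩
  have hm0 : (0 : ℝ) < m := by
    rw [← hm]
    exact_mod_cast Finset.card_pos.mpr ⟨u, hu⟩
  set t : ℝ := 2 * (D * ε * m) with ht
  have ht0 : 0 ≤ t := by positivity
  set N : α → Finset α := fun y => U.filter fun x => x ≠ y ∧ |π x - π y| ≤ t with hN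
  set W : Finset α := ((N u).erase v) ∪ ((N v).erase u) with hW
  set P : Finset (Σ _ : α, α) :=
    ((U.erase u).erase v).sigma fun y => ((N y).erase u).erase v with hP
  set A := W.biUnion fun x => (U.powersetCard k).filter fun S => {x, u, v} ⊆ S with hA
  set B := P.biUnion fun p => (U.powersetCard k).filter fun S => {p.1, p.2, u, v} ⊆ S with hB
  have hNcard : ∀ y ∈ U, ((N y).card : ℝ) ≤ 2 * t := fun y hy => card_close_le hπ ht0 hy
  have hWcard : (W.card : ℝ) ≤ 4 * t := by
    have h : W.card ≤ (N u).card + (N v).card := (Finset.card_union_le _ _).trans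
      (add_le_add (Finset.card_erase_le) (Finset.card_erase_le))
    have h' : (W.card : ℝ) ≤ (N u).card + (N v).card := by exact_mod_cast h
    linarith [hNcard u hu, hNcard v hv]
  have hPcard : (P.card : ℝ) ≤ 2 * t * m := by
    rw [hP, Finset.card_sigma]
    push_cast
    calc _ ≤ ∑ _y ∈ (U.erase u).erase v, 2 * t := Finset.sum_le_sum fun y hy =>
          le_trans (by exact_mod_cast Finset.card_erase_le.trans Finset.card_erase_le)
            (hNcard y (Finset.mem_of_mem_erase (Finset.mem_of_mem_erase hy)))
      _ = ((U.erase u).erase v).card * (2 * t) := by rw [Finset.sum_const, nsmul_eq_mul]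
      _ ≤ m * (2 * t) := by
          refine mul_le_mul_of_nonneg_right ?_ (by positivity)
          rw [← hm]
          exact_mod_cast Finset.card_erase_le.trans Finset.card_erase_le
      _ = _ := by ring
  have hmk : (m : ℝ) ^ k = m ^ (k - 2) * m ^ 2 := by rw [← pow_add, Nat.sub_add_cancel hk]
  have hAcard : (A.card : ℝ) ≤ 8 * D * ε * m ^ (k - 2) := by
    have h := card_biUnion_supersets_mul_le U k 3 W (fun x => {x, u, v}) (by
      intro x hx
      refine Finset.card_eq_three.mpr ⟨x, u, v, ?_, ?_, huv, rfl⟩ <;> grind)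
    rw [hm] at h
    have h' : (A.card : ℝ) * m ^ 3 ≤ W.card * m ^ k := by exact_mod_cast h
    refine le_of_mul_le_mul_right (h'.trans ?_) (pow_pos hm0 3)
    calc _ ≤ 4 * t * (m : ℝ) ^ k := mul_le_mul_of_nonneg_right hWcard (by positivity)
      _ = _ := by rw [hmk, ht]; ring
  have hBcard : (B.card : ℝ) ≤ 4 * D * ε * m ^ (k - 2) := by
    have h := card_biUnion_supersets_mul_le U k 4 P (fun p => {p.1, p.2, u, v}) (by
      intro p hp
      have hp' := Finset.mem_sigma.mp hp
      rw [Finset.card_insert_of_notMem, Finset.card_eq_three.mpr ⟨p.2, u, v, ?_, ?_, huv, rfl⟩]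
        <;> grind)
    rw [hm] at h
    have h' : (B.card : ℝ) * m ^ 4 ≤ P.card * m ^ k := by exact_mod_cast h
    refine le_of_mul_le_mul_right (h'.trans ?_) (pow_pos hm0 4)
    calc _ ≤ 2 * t * m * (m : ℝ) ^ k := mul_le_mul_of_nonneg_right hPcard (by positivity)
      _ = _ := by rw [hmk, ht]; ring
  have hsub : ((U.powersetCard k).filter fun S => u ∈ S ∧ v ∈ S ∧ c S (wgtOrd S σ u v) = 1) ⊆
      ((U.powersetCard k).filter fun S => u ∈ S ∧ v ∈ S ∧ c S (wgtOrd S π u v) = 1) ∪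
        (A ∪ B) := by
    intro S hS
    obtain ⟨hSk, huS, hvS, hcS⟩ := Finset.mem_filter.mp hS
    have hSU := (Finset.mem_powersetCard.mp hSk).1
    rw [Finset.mem_union]
    by_cases hAB : S ∈ A ∪ B
    · exact Or.inr hAB
    refine Or.inl (Finset.mem_filter.mpr ⟨hSk, huS, hvS, ?_⟩)
    rw [← (hc S hSk).2 _ _ (sameOrderOn_wgtOrd (hπ.injOn.mono (Finset.coe_subset.mpr hSU))
      (hσ.mono (Finset.coe_subset.mpr hSU)) huS hvS ?_)]
    · exact hcS
    intro x hx hxu hxv y hy hxy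
    refine lt_iff_lt_of_abs_sub_le (hclose x (hSU hx)) (hclose y (hSU hy)) ?_
    by_contra hle
    rw [not_lt] at hle
    have hxN : x ∈ N y := Finset.mem_filter.mpr ⟨hSU hx, hxy, hle⟩
    refine hAB (Finset.mem_union.mpr ?_)
    by_cases hyuv : y = u ∨ y = v
    · refine Or.inl (Finset.mem_biUnion.mpr ⟨x, ?_, Finset.mem_filter.mpr ⟨hSk, ?_⟩⟩)
      · rcases hyuv with rfl | rfl
        · exact Finset.mem_union_left _ (Finset.mem_erase.mpr ⟨hxv, hxN⟩)
        · exact Finset.mem_union_right _ (Finset.mem_erase.mpr ⟨hxu, hxN⟩)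
      · simp [Finset.insert_subset_iff, hx, huS, hvS]
    · rw [not_or] at hyuv
      refine Or.inr (Finset.mem_biUnion.mpr ⟨⟨y, x⟩, ?_, Finset.mem_filter.mpr ⟨hSk, ?_⟩⟩)
      · simp only [hP, Finset.mem_sigma, Finset.mem_erase]
        exact ⟨⟨hyuv.2, hyuv.1, hSU hy⟩, hxv, hxu, hxN⟩
      · simp [Finset.insert_subset_iff, hx, hy, huS, hvS]
  rw [wgt_eq_card_wgtOrd, wgt_eq_card_wgtOrd U k c π]
  have hle := (Finset.card_le_card hsub).trans ((Finset.card_union_le _ _).trans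
    (Nat.add_le_add_left (Finset.card_union_le _ _) _))
  have hle' := (Nat.cast_le (α := ℝ)).mpr hle
  push_cast at hle'
  linarith
end

section
/- For every k ≥ 2 and D > 0 there exist constants C', m₀ and ε₀ > 0 such that the following holds. Let c be a fully dense weakly fragile arity-k constraint system on a finite set U with |U| = m ≥ m₀, let 0 < ε ≤ ε₀, let π be a ranking of U and σ an ordering of U with |π(x) − σ(x)| ≤ D·ε·m for all x ∈ U. Then C^{w̄^σ}(π) ≤ (1 + C'·ε) · C(k,2) · C^c(π), where C(k,2) is the binomial coefficient 'k choose 2'. -/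
open scoped Classical

universe u

section

variable {α : Type u}

lemma rk_lt_rk_iff_s17 {S : Finset α} {σ : α → ℝ} {a b : α} (hb : b ∈ S) :
    rk S σ a < rk S σ b ↔ σ a < σ b := by
  constructor
  · intro h
    by_contra! hab
    exact absurd h (not_lt.2 (Finset.card_le_card
      (Finset.monotone_filter_right S fun z _ hz => le_trans hz hab)))
  · intro h
    refine Finset.card_lt_card (Finset.ssubset_iff_of_subset
      (Finset.monotone_filter_right S fun z _ hz => le_trans hz h.le) |>.2 ⟨b, ?_, ?_⟩)
    · simp [hb]
    · simp [h]

lemma rk_le_rk_iff {S : Finset α} {σ : α → ℝ} {a b : α} (ha : a ∈ S) :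
    rk S σ a ≤ rk S σ b ↔ σ a ≤ σ b := by
  rw [← not_lt, rk_lt_rk_iff_s17 ha, not_lt]

lemma sameOrderOn_rk (S : Finset α) (σ : α → ℝ) :
    SameOrderOn S (fun x => (rk S σ x : ℝ)) σ := fun x _ y hy => by
  simpa using rk_lt_rk_iff_s17 hy

lemma rk_injOn {S : Finset α} {σ : α → ℝ} (hσ : Set.InjOn σ S) : Set.InjOn (rk S σ) S := by
  intro a ha b hb hab
  exact hσ ha hb (le_antisymm ((rk_le_rk_iff ha).1 hab.le) ((rk_le_rk_iff hb).1 hab.ge))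

lemma isRankingOn_rk {S : Finset α} {σ : α → ℝ} (hσ : Set.InjOn σ S) :
    IsRankingOn S (fun x => (rk S σ x : ℝ)) := by
  have hmaps : S.image (rk S σ) ⊆ Finset.Icc 1 S.card := by
    intro i hi
    obtain ⟨x, hx, rfl⟩ := Finset.mem_image.1 hi
    refine Finset.mem_Icc.2 ⟨Finset.card_pos.2 ⟨x, by simp [hx]⟩,
      Finset.card_le_card (Finset.filter_subset _ _)⟩
  have himage : S.image (rk S σ) = Finset.Icc 1 S.card :=
    Finset.eq_of_subset_of_card_le hmaps
      (by rw [Finset.card_image_of_injOn (rk_injOn hσ)]; simp)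
  refine ⟨fun x hx => ⟨rk S σ x, ?_, rfl⟩,
    fun a ha b hb hab => rk_injOn hσ ha hb (Nat.cast_injective hab), ?_⟩
  · simpa using hmaps (Finset.mem_image_of_mem _ hx)
  · rintro _ ⟨i, hi, rfl⟩
    have : i ∈ S.image (rk S σ) := by rw [himage]; simpa using hi
    obtain ⟨x, hx, rfl⟩ := Finset.mem_image.1 this
    exact ⟨x, hx, rfl⟩

lemma moveBefore_self (S : Finset α) (σ : α → ℝ) (v u : α) :
    moveBefore S σ v u v = rk S σ u - 1 / 2 := by
  simp [moveBefore]

lemma moveBefore_of_ne (S : Finset α) (σ : α → ℝ) {v u a : α} (h : a ≠ v) :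
    moveBefore S σ v u a = rk S σ a := by
  simp [moveBefore, h]

lemma natCast_lt_sub_half_iff (a b : ℕ) : (a : ℝ) < b - 1 / 2 ↔ a < b := by
  constructor
  · intro h
    have : (a : ℝ) < b := by linarith
    exact_mod_cast this
  · intro h
    have : (a : ℝ) + 1 ≤ b := by exact_mod_cast h
    linarith

lemma sub_half_lt_natCast_iff (a b : ℕ) : (a : ℝ) - 1 / 2 < b ↔ a ≤ b := by
  constructor
  · intro h
    by_contra! hab
    have : (b : ℝ) + 1 ≤ a := by exact_mod_cast hab
    linarith
  · intro h
    have : (a : ℝ) ≤ b := by exact_mod_cast h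
    linarith

lemma moveBefore_injOn {S : Finset α} {σ : α → ℝ} (hσ : Set.InjOn σ S) (v u : α) :
    Set.InjOn (moveBefore S σ v u) S := by
  have key : ∀ i j : ℕ, (i : ℝ) ≠ j - 1 / 2 := by
    intro i j h
    have : 2 * (i : ℝ) + 1 = 2 * j := by linarith
    have : 2 * i + 1 = 2 * j := by exact_mod_cast this
    omega
  intro a ha b hb hab
  by_cases hav : a = v <;> by_cases hbv : b = v
  · rw [hav, hbv]
  · subst hav
    rw [moveBefore_self, moveBefore_of_ne _ _ hbv] at hab
    exact absurd hab.symm (key _ _)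
  · subst hbv
    rw [moveBefore_self, moveBefore_of_ne _ _ hav] at hab
    exact absurd hab (key _ _)
  · rw [moveBefore_of_ne _ _ hav, moveBefore_of_ne _ _ hbv] at hab
    exact rk_injOn hσ ha hb (Nat.cast_injective hab)

lemma SameOrderOn.symm {S : Finset α} {f g : α → ℝ} (h : SameOrderOn S f g) :
    SameOrderOn S g f := fun x hx y hy => (h x hx y hy).symm

lemma SameOrderOn.trans {S : Finset α} {f g h : α → ℝ} (hfg : SameOrderOn S f g)
    (hgh : SameOrderOn S g h) : SameOrderOn S f h :=
  fun x hx y hy => (hfg x hx y hy).trans (hgh x hx y hy)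

/-- If the elements of `S` other than `x, y` all lie before, between, or after the pair `x, y`,
then moving `y` immediately before `x` is one of the four weak moves. -/
lemma weakMove_moveBefore {S : Finset α} {σ : α → ℝ} {x y : α} (hx : x ∈ S)
    (hy : y ∈ S) (hxy : σ x < σ y)
    (hS : (∀ z ∈ S, z ≠ x → z ≠ y → σ z < σ x) ∨
      (∀ z ∈ S, z ≠ x → z ≠ y → σ x < σ z ∧ σ z < σ y) ∨
      (∀ z ∈ S, z ≠ x → z ≠ y → σ y < σ z)) :
    WeakMove S (fun z => (rk S σ z : ℝ))
      (fun z => (rk S (moveBefore S σ y x) z : ℝ)) := by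
  have hne : x ≠ y := by rintro rfl; exact lt_irrefl _ hxy
  have hdiff : ∃ z ∈ S, (rk S σ z : ℝ) ≠ rk S (moveBefore S σ y x) z := by
    by_contra! h
    have h1 : rk S σ x < rk S σ y := (rk_lt_rk_iff_s17 hy).2 hxy
    have h2 : rk S (moveBefore S σ y x) y < rk S (moveBefore S σ y x) x := by
      rw [rk_lt_rk_iff_s17 hx, moveBefore_self, moveBefore_of_ne _ _ hne]
      linarith
    have h3 : rk S σ x = rk S (moveBefore S σ y x) x := by exact_mod_cast h x hx
    have h4 : rk S σ y = rk S (moveBefore S σ y x) y := by exact_mod_cast h y hy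
    omega
  have hlast (h : ∀ z ∈ S, z ≠ y → σ z < σ y) : rk S σ y = S.card := by
    rw [rk, Finset.filter_true_of_mem]
    intro z hz
    by_cases hzy : z = y
    · rw [hzy]
    · exact (h z hz hzy).le
  have hfirst (h : ∀ z ∈ S, z ≠ x → σ x < σ z) : rk S σ x = 1 := by
    rw [rk, Finset.card_eq_one]
    refine ⟨x, Finset.ext fun z => ?_⟩
    rw [Finset.mem_filter, Finset.mem_singleton]
    refine ⟨fun hz => ?_, ?_⟩
    · by_contra hzx
      exact absurd (h z hz.1 hzx) (not_lt.2 hz.2)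
    · rintro rfl
      exact ⟨hx, le_rfl⟩
  rcases hS with hS | hS | hS
  · have hy' : rk S σ y = S.card := hlast fun z hz hzy => by
      by_cases hzx : z = x
      · rwa [hzx]
      · exact (hS z hz hzx hzy).trans hxy
    have hx' : (rk S σ x : ℝ) = S.card - 1 := by
      have : S.filter (fun z => σ z ≤ σ x) = S.erase y := by
        ext z
        rw [Finset.mem_filter, Finset.mem_erase]
        constructor
        · rintro ⟨hz, hzx⟩
          refine ⟨?_, hz⟩
          rintro rfl
          linarith
        · rintro ⟨hzy, hz⟩
          refine ⟨hz, ?_⟩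
          by_cases hzx : z = x
          · rw [hzx]
          · exact (hS z hz hzx hzy).le
      rw [rk, this, Finset.cast_card_erase_of_mem hy]
    refine ⟨y, hy, S.card - 3 / 2, .inr (.inr (.inl ⟨by simp [hy'], rfl⟩)), ?_, hdiff⟩
    convert sameOrderOn_rk S (moveBefore S σ y x) using 1
    rw [moveBefore, hx']
    ring_nf
  · have hy' : rk S σ y = S.card := hlast fun z hz hzy => by
      by_cases hzx : z = x
      · rwa [hzx]
      · exact (hS z hz hzx hzy).2
    have hx' : rk S σ x = 1 := hfirst fun z hz hzx => by
      by_cases hzy : z = y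
      · rwa [hzy]
      · exact (hS z hz hzx hzy).1
    refine ⟨y, hy, 1 / 2, .inr (.inr (.inr ⟨by simp [hy'], rfl⟩)), ?_, hdiff⟩
    convert sameOrderOn_rk S (moveBefore S σ y x) using 1
    rw [moveBefore, hx']
    norm_num
  · have hx' : rk S σ x = 1 := hfirst fun z hz hzx => by
      by_cases hzy : z = y
      · rwa [hzy]
      · exact hxy.trans (hS z hz hzx hzy)
    have hy' : rk S σ y = 2 := by
      have : S.filter (fun z => σ z ≤ σ y) = {x, y} := by
        ext z
        rw [Finset.mem_filter, Finset.mem_insert, Finset.mem_singleton]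
        constructor
        · rintro ⟨hz, hzy⟩
          by_contra! h
          exact absurd (hS z hz h.1 h.2) (not_lt.2 hzy)
        · rintro (rfl | rfl)
          · exact ⟨hx, hxy.le⟩
          · exact ⟨hy, le_rfl⟩
      rw [rk, this, Finset.card_pair hne]
    have hz' : ∀ z ∈ S, z ≠ x → z ≠ y → (3 : ℝ) ≤ rk S σ z := by
      intro z hz hzx hzy
      have := (rk_lt_rk_iff_s17 (a := y) hz).2 (hS z hz hzx hzy)
      rw [hy'] at this
      exact_mod_cast this
    refine ⟨x, hx, 2 + 1 / 2, .inl ⟨by simp [hx'], rfl⟩, ?_, hdiff⟩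
    refine (sameOrderOn_rk S (moveBefore S σ y x)).trans fun a ha b hb => ?_
    have hval : ∀ a ∈ S, (a = x ∧ moveBefore S σ y x a = 1 ∧
          Function.update (fun z => (rk S σ z : ℝ)) x (2 + 1 / 2) a = 5 / 2) ∨
        (a = y ∧ moveBefore S σ y x a = 1 / 2 ∧
          Function.update (fun z => (rk S σ z : ℝ)) x (2 + 1 / 2) a = 2) ∨
        (3 ≤ moveBefore S σ y x a ∧ moveBefore S σ y x a =
          Function.update (fun z => (rk S σ z : ℝ)) x (2 + 1 / 2) a) := by
      intro a ha
      by_cases hax : a = x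
      · subst hax
        refine .inl ⟨rfl, ?_, ?_⟩
        · rw [moveBefore_of_ne _ _ hne, hx']; simp
        · simp; norm_num
      by_cases hay : a = y
      · subst hay
        refine .inr (.inl ⟨rfl, ?_, ?_⟩)
        · rw [moveBefore_self, hx']; norm_num
        · rw [Function.update_of_ne hax, hy']; norm_num
      · refine .inr (.inr ?_)
        rw [moveBefore_of_ne _ _ hay, Function.update_of_ne hax]
        exact ⟨hz' a ha hax hay, rfl⟩
    rcases hval a ha with ⟨_, h1, h2⟩ | ⟨_, h1, h2⟩ | ⟨h1, h2⟩ <;>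
      rcases hval b hb with ⟨_, h3, h4⟩ | ⟨_, h3, h4⟩ | ⟨h3, h4⟩ <;>
      constructor <;> intro h <;> linarith

lemma one_le_cost_moveBefore_add {S : Finset α} {σ : α → ℝ} {c : (α → ℝ) → ℕ}
    (hσ : Set.InjOn σ S) (hc : ∀ f g : α → ℝ, SameOrderOn S f g → c f = c g)
    (hf : WeaklyFragileOn S c) {x y : α} (hx : x ∈ S) (hy : y ∈ S) (hxy : σ x < σ y)
    (hS : (∀ z ∈ S, z ≠ x → z ≠ y → σ z < σ x) ∨
      (∀ z ∈ S, z ≠ x → z ≠ y → σ x < σ z ∧ σ z < σ y) ∨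
      (∀ z ∈ S, z ≠ x → z ≠ y → σ y < σ z)) :
    1 ≤ c σ + c (moveBefore S σ y x) := by
  have := hf _ _ (isRankingOn_rk hσ) (isRankingOn_rk (moveBefore_injOn hσ y x))
    (weakMove_moveBefore hx hy hxy hS)
  rwa [hc _ _ (sameOrderOn_rk S σ), hc _ _ (sameOrderOn_rk S (moveBefore S σ y x))] at this

/-- If `y` precedes `x` in `π` and no pair of elements of `S` other than `{x, y}` is a
`π`/`σ`-inversion, then `σ` with `y` moved immediately before `x` induces the order of `π`. -/
lemma sameOrderOn_moveBefore {S : Finset α} {π σ : α → ℝ}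
    (hσ : Set.InjOn σ S) {x y : α} (hx : x ∈ S) (hy : y ∈ S) (hyx : π y < π x)
    (hσxy : σ x < σ y)
    (h : ∀ a ∈ S, ∀ b ∈ S, b ≠ x → b ≠ y →
      ((π a < π b ↔ σ a < σ b) ∧ (π b < π a ↔ σ b < σ a))) :
    SameOrderOn S (moveBefore S σ y x) π := by
  intro a ha b hb
  have hne : x ≠ y := by rintro rfl; exact lt_irrefl _ hσxy
  by_cases hay : a = y <;> by_cases hby : b = y
  · subst hay hby; simp
  · subst hay
    rw [moveBefore_self, moveBefore_of_ne _ _ hby, sub_half_lt_natCast_iff, rk_le_rk_iff hx]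
    by_cases hbx : b = x
    · subst hbx; simp [hyx]
    have h1 := (h a ha b hb hbx hby).1
    have h2 := (h x hx b hb hbx hby).1
    have h3 : σ x ≠ σ b := fun e => hbx (hσ hx hb e).symm
    refine ⟨fun hle => hyx.trans (h2.2 (lt_of_le_of_ne hle h3)), fun hlt => ?_⟩
    exact (hσxy.trans (h1.1 hlt)).le
  · subst hby
    rw [moveBefore_self, moveBefore_of_ne _ _ hay, natCast_lt_sub_half_iff, rk_lt_rk_iff_s17 hx]
    by_cases hax : a = x
    · subst hax
      simp [hyx.le]
    have h1 := (h b hb a ha hax hay).2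
    have h2 := (h x hx a ha hax hay).2
    exact ⟨fun hlt => h1.2 (hlt.trans hσxy), fun hlt => h2.1 (hlt.trans hyx)⟩
  · rw [moveBefore_of_ne _ _ hay, moveBefore_of_ne _ _ hby, Nat.cast_lt, rk_lt_rk_iff_s17 hb]
    by_cases hbx : b = x
    · by_cases hax : a = x
      · subst hbx hax; simp
      · exact (h b hb a ha hax hay).2.symm
    · exact (h a ha b hb hbx hby).1.symm

/-- `σ` and `π` order the pair `a, b` the same way. -/
def Concordant (π σ : α → ℝ) (a b : α) : Prop :=
  (π a < π b ↔ σ a < σ b) ∧ (π b < π a ↔ σ b < σ a)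

lemma Concordant.symm {π σ : α → ℝ} {a b : α} (h : Concordant π σ a b) : Concordant π σ b a :=
  ⟨h.2, h.1⟩

/-- The elements of `U` that form a `π`/`σ`-inversion with `z`. -/
noncomputable def discordantSet (U : Finset α) (π σ : α → ℝ) (z : α) : Finset α :=
  U.filter fun a => ¬ Concordant π σ a z

lemma card_superset_mul_pow_le (U T : Finset α) (k : ℕ) :
    ((U.powersetCard k).filter fun S => T ⊆ S).card * U.card ^ T.card ≤ U.card ^ k := by
  by_cases htk : T.card ≤ k
  · have h : ((U.powersetCard k).filter fun S => T ⊆ S).card ≤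
        ((U \ T).powersetCard (k - T.card)).card := by
      refine Finset.card_le_card_of_injOn (fun S => S \ T) ?_ ?_
      · intro S hS
        simp only [Finset.coe_filter, Finset.mem_powersetCard, Set.mem_ofPred_eq] at hS
        simp only [Finset.mem_coe, Finset.mem_powersetCard]
        refine ⟨Finset.sdiff_subset_sdiff hS.1.1 le_rfl, ?_⟩
        rw [Finset.card_sdiff_of_subset hS.2, hS.1.2]
      · intro S hS S' hS' h
        simp only [Finset.coe_filter, Finset.mem_powersetCard, Set.mem_ofPred_eq] at hS hS'
        rw [← Finset.sdiff_union_of_subset hS.2, ← Finset.sdiff_union_of_subset hS'.2]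
        exact congrArg (· ∪ T) h
    rw [Finset.card_powersetCard] at h
    calc _ ≤ U.card ^ (k - T.card) * U.card ^ T.card := by
          refine Nat.mul_le_mul_right _ (h.trans ((Nat.choose_le_pow _ _).trans ?_))
          exact Nat.pow_le_pow_left (Finset.card_le_card Finset.sdiff_subset) _
      _ = U.card ^ k := by rw [← pow_add, Nat.sub_add_cancel htk]
  · have : ((U.powersetCard k).filter fun S => T ⊆ S) = ∅ := by
      refine Finset.filter_eq_empty_iff.2 fun S hS hTS => htk ?_
      rw [← (Finset.mem_powersetCard.1 hS).2]
      exact Finset.card_le_card hTS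
    simp [this]

lemma card_superset_le_div {U : Finset α} (T : Finset α) (k : ℕ) (hU : 0 < U.card) :
    ((((U.powersetCard k).filter fun S => T ⊆ S).card : ℕ) : ℝ) ≤
      (U.card : ℝ) ^ k / (U.card : ℝ) ^ T.card := by
  rw [le_div_iff₀ (by positivity)]
  exact_mod_cast card_superset_mul_pow_le U T k

lemma card_discordantSet_le {U : Finset α} {π σ : α → ℝ} (hπ : IsRankingOn U π) {L : ℝ}
    (hL : ∀ x ∈ U, |π x - σ x| ≤ L) {z : α} (hz : z ∈ U) :
    ((discordantSet U π σ z).card : ℝ) ≤ 4 * L := by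
  have hL0 : 0 ≤ L := (abs_nonneg _).trans (hL z hz)
  have hint : ∀ a ∈ U, π a = ⌊π a⌋ := by
    intro a ha
    obtain ⟨i, -, hi⟩ := hπ.mapsTo ha
    simp only at hi
    rw [← hi]
    simp
  have hcard : (discordantSet U π σ z).card ≤
      ((Finset.Icc (-⌊2 * L⌋) ⌊2 * L⌋).erase 0).card := by
    refine Finset.card_le_card_of_injOn (fun a => ⌊π a⌋ - ⌊π z⌋) ?_ ?_
    · intro a ha
      obtain ⟨haU, hd⟩ := Finset.mem_filter.1 ha
      have hza := abs_le.1 (hL z hz)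
      have haa := abs_le.1 (hL a haU)
      have hle : |π a - π z| ≤ 2 * L := by
        by_contra! h
        apply hd
        rcases lt_abs.1 h with h | h
        · exact ⟨⟨fun _ => by linarith, fun _ => by linarith⟩,
            ⟨fun _ => by linarith, fun _ => by linarith⟩⟩
        · exact ⟨⟨fun _ => by linarith, fun _ => by linarith⟩,
            ⟨fun _ => by linarith, fun _ => by linarith⟩⟩
      have hcast : π a - π z = ((⌊π a⌋ - ⌊π z⌋ : ℤ) : ℝ) := by
        rw [Int.cast_sub, ← hint a haU, ← hint z hz]
      rw [hcast, abs_le] at hle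
      rw [Finset.mem_coe, Finset.mem_erase, Finset.mem_Icc]
      refine ⟨fun h0 => ?_, ?_, Int.le_floor.2 hle.2⟩
      · simp only at h0
        rw [h0, Int.cast_zero, sub_eq_zero] at hcast
        rw [hπ.injOn haU hz hcast] at hd
        exact hd ⟨by simp, by simp⟩
      · rw [neg_le]
        apply Int.le_floor.2
        rw [Int.cast_neg]
        linarith [hle.1]
    · intro a ha b hb hab
      have haU := (Finset.mem_filter.1 ha).1
      have hbU := (Finset.mem_filter.1 hb).1
      refine hπ.injOn haU hbU ?_
      rw [hint a haU, hint b hbU, sub_left_inj.1 hab]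
  have h0 : 0 ≤ ⌊2 * L⌋ := Int.floor_nonneg.2 (by linarith)
  rw [Finset.card_erase_of_mem (by simp [h0]), Int.card_Icc] at hcard
  have h1 : ((discordantSet U π σ z).card : ℤ) ≤ 2 * ⌊2 * L⌋ := by omega
  have h2 : ((discordantSet U π σ z).card : ℝ) ≤ 2 * (⌊2 * L⌋ : ℝ) := by exact_mod_cast h1
  linarith [Int.floor_le (2 * L)]

/-- The number of `k`-sets containing `x` and `y` and a discordant pair other than `{x, y}`. -/
lemma card_discordant_le {U : Finset α} {k : ℕ} {π σ : α → ℝ} (hπ : IsRankingOn U π) {L : ℝ}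
    (hL : ∀ x ∈ U, |π x - σ x| ≤ L) {x y : α} (hx : x ∈ U) (hy : y ∈ U) (hxy : x ≠ y) :
    ((((U.powersetCard k).filter fun S => x ∈ S ∧ y ∈ S ∧
      ∃ a ∈ S, ∃ b ∈ S, b ≠ x ∧ b ≠ y ∧ ¬ Concordant π σ a b).card : ℕ) : ℝ) ≤
      12 * L * ((U.card : ℝ) ^ k / (U.card : ℝ) ^ 3) := by
  have hU : 0 < U.card := Finset.card_pos.2 ⟨x, hx⟩
  have hL0 : 0 ≤ L := (abs_nonneg _).trans (hL x hx)
  set q : ℝ := (U.card : ℝ) ^ k / (U.card : ℝ) ^ 3 with hq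
  have hq0 : 0 ≤ q := by positivity
  let F : Finset α → Finset (Finset α) := fun T => (U.powersetCard k).filter fun S => T ⊆ S
  let E : α → Finset α := fun z => (discordantSet U π σ z \ {x, y})
  have hEcard : ∀ z ∈ U, ((E z).card : ℝ) ≤ 4 * L := fun z hz =>
    le_trans (by exact_mod_cast Finset.card_le_card Finset.sdiff_subset)
      (card_discordantSet_le hπ hL hz)
  have hEne : ∀ z, ∀ b ∈ E z, b ≠ x ∧ b ≠ y ∧ b ≠ z := by
    intro z b hb
    have h := Finset.mem_sdiff.1 hb
    have h' := h.2
    simp only [Finset.mem_insert, Finset.mem_singleton, not_or] at h'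
    refine ⟨h'.1, h'.2, ?_⟩
    rintro rfl
    exact (Finset.mem_filter.1 h.1).2 ⟨by simp, by simp⟩
  have hsub : ((U.powersetCard k).filter fun S => x ∈ S ∧ y ∈ S ∧
      ∃ a ∈ S, ∃ b ∈ S, b ≠ x ∧ b ≠ y ∧ ¬ Concordant π σ a b) ⊆
      ((E x).biUnion fun b => F {x, y, b}) ∪ ((E y).biUnion fun b => F {x, y, b}) ∪
      ((U \ {x, y}).biUnion fun b => (E b).biUnion fun a => F {x, y, b, a}) := by
    intro S hS
    obtain ⟨hSP, hxS, hyS, a, ha, b, hb, hbx, hby, hd⟩ := Finset.mem_filter.1 hS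
    have hSU := (Finset.mem_powersetCard.1 hSP).1
    have hmem : ∀ {a b : α}, b ∈ S → b ≠ x → b ≠ y → ¬ Concordant π σ b a → b ∈ E a :=
      fun hb hbx hby hd => Finset.mem_sdiff.2
        ⟨Finset.mem_filter.2 ⟨hSU hb, hd⟩, by simp [hbx, hby]⟩
    have hd' : ¬ Concordant π σ b a := fun h => hd h.symm
    rw [Finset.mem_union, Finset.mem_union]
    by_cases hax : a = x
    · subst hax
      refine .inl (.inl (Finset.mem_biUnion.2 ⟨b, hmem hb hbx hby hd', ?_⟩))
      exact Finset.mem_filter.2 ⟨hSP, by simp [Finset.insert_subset_iff, *]⟩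
    by_cases hay : a = y
    · subst hay
      refine .inl (.inr (Finset.mem_biUnion.2 ⟨b, hmem hb hbx hby hd', ?_⟩))
      exact Finset.mem_filter.2 ⟨hSP, by simp [Finset.insert_subset_iff, *]⟩
    refine .inr (Finset.mem_biUnion.2 ⟨b, ?_, Finset.mem_biUnion.2 ⟨a, hmem ha hax hay hd, ?_⟩⟩)
    · simp [hSU hb, hbx, hby]
    · exact Finset.mem_filter.2 ⟨hSP, by simp [Finset.insert_subset_iff, *]⟩
  have hthree : ∀ z, (z = x ∨ z = y) →
      ((((E z).biUnion fun b => F {x, y, b}).card : ℕ) : ℝ) ≤ 4 * L * q := by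
    intro z hz
    have hzU : z ∈ U := by rcases hz with rfl | rfl <;> assumption
    calc _ ≤ ∑ b ∈ E z, ((F {x, y, b}).card : ℝ) := by
          exact_mod_cast Finset.card_biUnion_le
      _ ≤ ∑ b ∈ E z, q := by
          refine Finset.sum_le_sum fun b hb => ?_
          obtain ⟨hbx, hby, -⟩ := hEne z b hb
          refine (card_superset_le_div _ k hU).trans_eq ?_
          rw [Finset.card_eq_three.2 ⟨x, y, b, hxy, hbx.symm, hby.symm, rfl⟩]
      _ ≤ 4 * L * q := by
          rw [Finset.sum_const, nsmul_eq_mul]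
          exact mul_le_mul_of_nonneg_right (hEcard z hzU) hq0
  have hfour : ((((U \ {x, y}).biUnion fun b =>
      (E b).biUnion fun a => F {x, y, b, a}).card : ℕ) : ℝ) ≤ 4 * L * q := by
    calc _ ≤ ∑ b ∈ U \ {x, y}, ∑ a ∈ E b, ((F {x, y, b, a}).card : ℝ) := by
          exact_mod_cast Finset.card_biUnion_le.trans
            (Finset.sum_le_sum fun b _ => Finset.card_biUnion_le)
      _ ≤ ∑ b ∈ U \ {x, y}, ∑ a ∈ E b, q / U.card := by
          refine Finset.sum_le_sum fun b hb => Finset.sum_le_sum fun a ha => ?_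
          obtain ⟨hax, hay, hab⟩ := hEne b a ha
          simp only [Finset.mem_sdiff, Finset.mem_insert, Finset.mem_singleton, not_or] at hb
          refine (card_superset_le_div _ k hU).trans_eq ?_
          have : ({x, y, b, a} : Finset α).card = 4 := by
            rw [Finset.card_insert_of_notMem, Finset.card_eq_three.2
              ⟨y, b, a, Ne.symm hb.2.2, hay.symm, hab.symm, rfl⟩]
            simp [hxy, Ne.symm hb.2.1, hax.symm]
          rw [this, hq, div_div, ← pow_succ]
      _ ≤ ∑ b ∈ U \ {x, y}, 4 * L * (q / U.card) := by
          refine Finset.sum_le_sum fun b hb => ?_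
          rw [Finset.sum_const, nsmul_eq_mul]
          exact mul_le_mul_of_nonneg_right (hEcard b (Finset.mem_sdiff.1 hb).1) (by positivity)
      _ ≤ U.card * (4 * L * (q / U.card)) := by
          rw [Finset.sum_const, nsmul_eq_mul]
          refine mul_le_mul_of_nonneg_right ?_ (by positivity)
          exact_mod_cast Finset.card_le_card Finset.sdiff_subset
      _ = 4 * L * q := by
          have : (U.card : ℝ) ≠ 0 := by positivity
          field_simp
  have hcard : ((((U.powersetCard k).filter fun S => x ∈ S ∧ y ∈ S ∧
      ∃ a ∈ S, ∃ b ∈ S, b ≠ x ∧ b ≠ y ∧ ¬ Concordant π σ a b).card : ℕ) : ℝ) ≤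
      ((E x).biUnion fun b => F {x, y, b}).card + ((E y).biUnion fun b => F {x, y, b}).card +
      ((U \ {x, y}).biUnion fun b => (E b).biUnion fun a => F {x, y, b, a}).card := by
    exact_mod_cast (Finset.card_le_card hsub).trans ((Finset.card_union_le _ _).trans
      (Nat.add_le_add_right (Finset.card_union_le _ _) _))
  linarith [hthree x (.inl rfl), hthree y (.inr rfl)]

lemma sameOrderOn_of_concordant {S : Finset α} {π σ : α → ℝ} {x y : α}
    (hxy : Concordant π σ x y) (hx : x ∈ S) (hy : y ∈ S)
    (h : ∀ a ∈ S, ∀ b ∈ S, b ≠ x → b ≠ y → Concordant π σ a b) : SameOrderOn S σ π := by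
  have hC : ∀ a ∈ S, ∀ b ∈ S, Concordant π σ a b := by
    intro a ha b hb
    by_cases hbx : b = x
    · by_cases hax : a = x
      · subst hbx hax; exact ⟨by simp, by simp⟩
      by_cases hay : a = y
      · subst hbx hay; exact hxy.symm
      exact (h b hb a ha hax hay).symm
    by_cases hby : b = y
    · by_cases hax : a = x
      · subst hby hax; exact hxy
      by_cases hay : a = y
      · subst hby hay; exact ⟨by simp, by simp⟩
      exact (h b hb a ha hax hay).symm
    exact h a ha b hb hbx hby
  exact fun a ha b hb => (hC a ha b hb).1.symm

lemma wgt_le {U : Finset α} {k : ℕ} {c : Finset α → (α → ℝ) → ℕ} {π σ : α → ℝ}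
    (hc : IsConstraintSystem U k c) (hπ : IsRankingOn U π) (hσ : IsOrderingOn U σ) {L : ℝ}
    (hL : ∀ x ∈ U, |π x - σ x| ≤ L) {x y : α} (hx : x ∈ U) (hy : y ∈ U) (hyx : π y < π x) :
    (wgt U k c σ x y : ℝ) ≤
      ((U.powersetCard k).filter fun S => (x ∈ S ∧ y ∈ S) ∧ c S π = 1).card +
      12 * L * ((U.card : ℝ) ^ k / (U.card : ℝ) ^ 3) := by
  have hne : x ≠ y := by rintro rfl; exact lt_irrefl _ hyx
  refine le_trans ?_ (add_le_add_right (card_discordant_le (k := k) hπ hL hx hy hne) _)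
  rw [wgt]
  norm_cast
  refine (Finset.card_le_card fun S hS => ?_).trans (Finset.card_union_le _ _)
  obtain ⟨hS, hxS, hyS, hcS⟩ := Finset.mem_filter.1 hS
  rw [Finset.mem_union, or_iff_not_imp_right]
  intro hbad
  refine Finset.mem_filter.2 ⟨hS, ⟨hxS, hyS⟩, ?_⟩
  have h : ∀ a ∈ S, ∀ b ∈ S, b ≠ x → b ≠ y → Concordant π σ a b := by
    intro a ha b hb hbx hby
    by_contra hd
    exact hbad (Finset.mem_filter.2 ⟨hS, hxS, hyS, a, ha, b, hb, hbx, hby, hd⟩)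
  split_ifs at hcS with hlt
  · rw [← hcS]
    exact ((hc S hS).2 _ _ (sameOrderOn_moveBefore
      (hσ.mono (Finset.coe_subset.2 (Finset.mem_powersetCard.1 hS).1)) hxS hyS hyx hlt h)).symm
  · rw [← hcS]
    have hlt' : σ y < σ x := lt_of_le_of_ne (not_lt.1 hlt) fun e => hne (hσ hy hx e).symm
    have hC : Concordant π σ x y := ⟨iff_of_false hyx.asymm hlt, iff_of_true hyx hlt'⟩
    exact ((hc S hS).2 _ _ (sameOrderOn_of_concordant hC hxS hyS h)).symm

lemma choose_le_wgt_add_wgt_of_lt {U : Finset α} {k : ℕ} (hk : 2 ≤ k)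
    {c : Finset α → (α → ℝ) → ℕ} {σ : α → ℝ}
    (hc : IsConstraintSystem U k c) (hf : WeaklyFragileSystem U k c) (hσ : IsOrderingOn U σ)
    {x y : α} (hx : x ∈ U) (hy : y ∈ U) (hxy : σ x < σ y) :
    ∃ r : ℕ, U.card - 2 ≤ 3 * r ∧ r.choose (k - 2) ≤ wgt U k c σ x y + wgt U k c σ y x := by
  have hne : x ≠ y := by rintro rfl; exact lt_irrefl _ hxy
  have key : ∀ R ⊆ U \ {x, y}, ((∀ z ∈ R, σ z < σ x) ∨ (∀ z ∈ R, σ x < σ z ∧ σ z < σ y) ∨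
      (∀ z ∈ R, σ y < σ z)) → R.card.choose (k - 2) ≤ wgt U k c σ x y + wgt U k c σ y x := by
    intro R hRU hR
    have hxR : x ∉ R := fun h => by simpa using hRU h
    have hyR : y ∉ R := fun h => by simpa using hRU h
    rw [← Finset.card_powersetCard, wgt, wgt]
    refine le_trans (Finset.card_le_card_of_injOn (fun Q => insert x (insert y Q)) ?_ ?_)
      (Finset.card_union_le _ _)
    · intro Q hQ
      obtain ⟨hQR, hQk⟩ := Finset.mem_powersetCard.1 hQ
      have hxQ : x ∉ insert y Q := by
        rw [Finset.mem_insert, not_or]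
        exact ⟨hne, fun h => hxR (hQR h)⟩
      have hSP : insert x (insert y Q) ∈ U.powersetCard k := by
        rw [Finset.mem_powersetCard]
        constructor
        · refine Finset.insert_subset hx (Finset.insert_subset hy ?_)
          exact (hQR.trans hRU).trans Finset.sdiff_subset
        · rw [Finset.card_insert_of_notMem hxQ,
            Finset.card_insert_of_notMem fun h => hyR (hQR h), hQk]
          omega
      have hxS : x ∈ insert x (insert y Q) := by simp
      have hyS : y ∈ insert x (insert y Q) := by simp
      have hin : ∀ z ∈ insert x (insert y Q), z ≠ x → z ≠ y → z ∈ R := by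
        intro z hz hzx hzy
        simp only [Finset.mem_insert, hzx, hzy, false_or] at hz
        exact hQR hz
      have hcS := hc _ hSP
      have hone := one_le_cost_moveBefore_add (c := c (insert x (insert y Q)))
        (hσ.mono (Finset.coe_subset.2 (Finset.mem_powersetCard.1 hSP).1)) hcS.2 (hf _ hSP)
        hxS hyS hxy (by
          rcases hR with hR | hR | hR
          · exact .inl fun z hz hzx hzy => hR z (hin z hz hzx hzy)
          · exact .inr (.inl fun z hz hzx hzy => hR z (hin z hz hzx hzy))
          · exact .inr (.inr fun z hz hzx hzy => hR z (hin z hz hzx hzy)))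
      have h1 := hcS.1 σ
      have h2 := hcS.1 (moveBefore (insert x (insert y Q)) σ y x)
      beta_reduce
      rw [Finset.mem_coe, Finset.mem_union, Finset.mem_filter, Finset.mem_filter, if_pos hxy,
        if_neg hxy.asymm]
      by_cases h0 : c (insert x (insert y Q)) σ = 1
      · exact .inr ⟨hSP, hyS, hxS, h0⟩
      · exact .inl ⟨hSP, hxS, hyS, by omega⟩
    · intro Q hQ Q' hQ' h
      have hd : ∀ Q ∈ R.powersetCard (k - 2), insert x (insert y Q) \ {x, y} = Q := by
        intro Q hQ
        have hQR := (Finset.mem_powersetCard.1 hQ).1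
        ext z
        simp only [Finset.mem_sdiff, Finset.mem_insert, Finset.mem_singleton]
        constructor
        · tauto
        · intro hz
          have hzx : z ≠ x := by rintro rfl; exact hxR (hQR hz)
          have hzy : z ≠ y := by rintro rfl; exact hyR (hQR hz)
          tauto
      rw [← hd Q hQ, ← hd Q' hQ']
      exact congrArg (· \ {x, y}) h
  let A := (U \ {x, y}).filter fun z => σ z < σ x
  let B := (U \ {x, y}).filter fun z => σ x < σ z ∧ σ z < σ y
  let C := (U \ {x, y}).filter fun z => σ y < σ z
  have hcover : U \ {x, y} ⊆ A ∪ B ∪ C := by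
    intro z hz
    have hz' := hz
    simp only [Finset.mem_sdiff, Finset.mem_insert, Finset.mem_singleton, not_or] at hz'
    have h1 : σ z ≠ σ x := fun e => hz'.2.1 (hσ hz'.1 hx e)
    have h2 : σ z ≠ σ y := fun e => hz'.2.2 (hσ hz'.1 hy e)
    rw [Finset.mem_union, Finset.mem_union, Finset.mem_filter, Finset.mem_filter,
      Finset.mem_filter]
    rcases h1.lt_or_gt with h1 | h1
    · exact .inl (.inl ⟨hz, h1⟩)
    rcases h2.lt_or_gt with h2 | h2
    · exact .inl (.inr ⟨hz, h1, h2⟩)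
    · exact .inr ⟨hz, h2⟩
  have hcard : U.card - 2 ≤ A.card + B.card + C.card := by
    have h2 : ({x, y} : Finset α) ⊆ U := by simp [Finset.insert_subset_iff, hx, hy]
    have h3 := Finset.card_sdiff_of_subset h2
    rw [Finset.card_pair hne] at h3
    rw [← h3]
    exact (Finset.card_le_card hcover).trans ((Finset.card_union_le _ _).trans
      (Nat.add_le_add_right (Finset.card_union_le _ _) _))
  have hA := key A (Finset.filter_subset _ _) (.inl fun z hz => (Finset.mem_filter.1 hz).2)
  have hB := key B (Finset.filter_subset _ _)
    (.inr (.inl fun z hz => (Finset.mem_filter.1 hz).2))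
  have hC := key C (Finset.filter_subset _ _)
    (.inr (.inr fun z hz => (Finset.mem_filter.1 hz).2))
  by_cases h1 : U.card - 2 ≤ 3 * A.card
  · exact ⟨_, h1, hA⟩
  by_cases h2 : U.card - 2 ≤ 3 * B.card
  · exact ⟨_, h2, hB⟩
  · exact ⟨C.card, by omega, hC⟩

lemma choose_le_wgt_add_wgt {U : Finset α} {k : ℕ} (hk : 2 ≤ k)
    {c : Finset α → (α → ℝ) → ℕ} {σ : α → ℝ}
    (hc : IsConstraintSystem U k c) (hf : WeaklyFragileSystem U k c) (hσ : IsOrderingOn U σ)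
    {x y : α} (hx : x ∈ U) (hy : y ∈ U) (hne : x ≠ y) :
    ∃ r : ℕ, U.card - 2 ≤ 3 * r ∧ r.choose (k - 2) ≤ wgt U k c σ x y + wgt U k c σ y x := by
  have hσne : σ x ≠ σ y := fun e => hne (hσ hx hy e)
  rcases hσne.lt_or_gt with h | h
  · exact choose_le_wgt_add_wgt_of_lt hk hc hf hσ hx hy h
  · rw [add_comm]
    exact choose_le_wgt_add_wgt_of_lt hk hc hf hσ hy hx h

lemma choose_le_mul_choose_of_le_three_mul {n r j : ℕ} (hn : n ≤ 3 * r)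
    (hj : 2 * j ^ 2 + 1 ≤ r) : (n.choose j : ℝ) ≤ 15 * 3 ^ j * r.choose j := by
  have hr : (0 : ℝ) < r := by exact_mod_cast (by omega : 0 < r)
  have hjr : j ≤ r := by nlinarith
  have hj' : 2 * (j : ℝ) ^ 2 ≤ r := by exact_mod_cast (by omega : 2 * j ^ 2 ≤ r)
  have hbern : 1 + (j : ℝ) * (-(j / r)) ≤ (1 + -(j / r : ℝ)) ^ j := by
    refine one_add_mul_le_pow ?_ j
    have : (j : ℝ) / r ≤ 1 := (div_le_one hr).2 (by exact_mod_cast hjr)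
    linarith
  have hhalf : (j : ℝ) * (j / r) ≤ 1 / 2 := by
    rw [← mul_div_assoc, div_le_iff₀ hr]
    linarith
  have hpow : (r : ℝ) ^ j ≤ 15 * ((r + 1 - j : ℕ) : ℝ) ^ j := by
    have h1 : (r : ℝ) * (1 + -(j / r : ℝ)) ≤ ((r + 1 - j : ℕ) : ℝ) := by
      have : ((r - j : ℕ) : ℝ) ≤ ((r + 1 - j : ℕ) : ℝ) := by
        exact_mod_cast (by omega : r - j ≤ r + 1 - j)
      rw [Nat.cast_sub hjr] at this
      refine le_trans (le_of_eq ?_) this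
      field_simp
      ring
    have h0 : (0 : ℝ) ≤ r * (1 + -(j / r : ℝ)) := by
      have : (j : ℝ) / r ≤ 1 := (div_le_one hr).2 (by exact_mod_cast hjr)
      exact mul_nonneg hr.le (by linarith)
    have h2 := pow_le_pow_left₀ h0 h1 j
    rw [mul_pow] at h2
    have h3 : (r : ℝ) ^ j * (1 / 2) ≤ (r : ℝ) ^ j * (1 + -(j / r : ℝ)) ^ j :=
      mul_le_mul_of_nonneg_left (by linarith) (by positivity)
    have h4 : (0 : ℝ) ≤ (r : ℝ) ^ j := by positivity
    linarith
  calc (n.choose j : ℝ) ≤ (n : ℝ) ^ j / j.factorial := Nat.choose_le_pow_div j n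
    _ ≤ (3 * r : ℝ) ^ j / j.factorial := by
        gcongr
        exact_mod_cast hn
    _ ≤ 3 ^ j * (15 * ((r + 1 - j : ℕ) : ℝ) ^ j) / j.factorial := by
        rw [mul_pow]
        gcongr
    _ = 15 * 3 ^ j * (((r + 1 - j : ℕ) : ℝ) ^ j / j.factorial) := by ring
    _ ≤ 15 * 3 ^ j * r.choose j := by
        gcongr
        exact Nat.pow_le_choose j r

lemma pow_div_sq_le_mul_choose {m k : ℕ} (hk : 2 ≤ k) (hm : 2 * k ≤ m) :
    (m : ℝ) ^ k / (m : ℝ) ^ 2 ≤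
      2 ^ (k - 2) * (k - 2).factorial * ((m - 2).choose (k - 2) : ℝ) := by
  have hm0 : (m : ℝ) ≠ 0 := by exact_mod_cast (by omega : m ≠ 0)
  obtain ⟨j, rfl⟩ := Nat.exists_eq_add_of_le' hk
  have h1 := Nat.pow_le_choose (α := ℝ) j (m - 2)
  rw [div_le_iff₀ (by positivity)] at h1
  have h2 : (m : ℝ) / 2 ≤ ((m - 2 + 1 - j : ℕ) : ℝ) := by
    rw [div_le_iff₀ (by norm_num)]
    exact_mod_cast (by omega : m ≤ (m - 2 + 1 - j) * 2)
  have h3 := pow_le_pow_left₀ (by positivity) h2 j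
  rw [pow_add, mul_div_assoc, div_self (pow_ne_zero 2 hm0), mul_one, Nat.add_sub_cancel]
  rw [div_pow, div_le_iff₀ (by positivity)] at h3
  have h4 : ((m - 2 + 1 - j : ℕ) : ℝ) ^ j * 2 ^ j ≤ (m - 2).choose j * j.factorial * 2 ^ j := by
    gcongr
  linarith

lemma sum_card_le_choose_mul_cost (U : Finset α) (k : ℕ) (c : Finset α → (α → ℝ) → ℕ)
    (π : α → ℝ) :
    ∑ p ∈ (U ×ˢ U).filter (fun p => π p.2 < π p.1),
      ((U.powersetCard k).filter fun S => (p.1 ∈ S ∧ p.2 ∈ S) ∧ c S π = 1).card ≤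
      k.choose 2 * cost U k c π := by
  rw [cost, Finset.mul_sum]
  refine (Finset.sum_card_bipartiteAbove_eq_sum_card_bipartiteBelow
    (fun (p : α × α) (S : Finset α) => (p.1 ∈ S ∧ p.2 ∈ S) ∧ c S π = 1)).trans_le ?_
  refine Finset.sum_le_sum fun S hS => ?_
  by_cases h1 : c S π = 1
  · have hk : k.choose 2 * c S π = (S.powersetCard 2).card := by
      rw [h1, mul_one, Finset.card_powersetCard, (Finset.mem_powersetCard.1 hS).2]
    rw [hk]
    refine Finset.card_le_card_of_injOn (fun p => {p.1, p.2}) ?_ ?_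
    · intro p hp
      simp only [Finset.bipartiteBelow, Finset.coe_filter, Finset.mem_filter,
        Set.mem_ofPred_eq] at hp
      have hne : p.1 ≠ p.2 := fun e => absurd hp.1.2 (by rw [e]; exact lt_irrefl _)
      simp [Finset.mem_powersetCard, Finset.insert_subset_iff, hp.2.1, Finset.card_pair hne]
    · rintro ⟨a, b⟩ hp ⟨a', b'⟩ hp' h
      simp only [Finset.bipartiteBelow, Finset.coe_filter, Finset.mem_filter,
        Set.mem_ofPred_eq] at hp hp' h
      have hlt := hp.1.2
      have hlt' := hp'.1.2
      have ha : a = a' ∨ a = b' := by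
        have : a ∈ ({a', b'} : Finset α) := h ▸ by simp
        simpa using this
      have hb : b = a' ∨ b = b' := by
        have : b ∈ ({a', b'} : Finset α) := h ▸ by simp
        simpa using this
      rcases ha with rfl | rfl <;> rcases hb with rfl | rfl
      · exact absurd hlt (lt_irrefl _)
      · rfl
      · exact absurd hlt hlt'.asymm
      · exact absurd hlt (lt_irrefl _)
  · simp [Finset.bipartiteBelow, h1]

end

/-- under the hypotheses of the previous statement,
`C^{w̄^σ}(π) ≤ (1 + C'·ε)·C(k,2)·C^c(π)`. -/
theorem costW_wbar_le (k : ℕ) (hk : 2 ≤ k) (D : ℝ) (hD : 0 < D) :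
    ∃ C' : ℝ, ∃ m₀ : ℕ, ∃ ε₀ : ℝ, 0 < ε₀ ∧
      ∀ (α : Type u) (U : Finset α) (m : ℕ), U.card = m → m₀ ≤ m →
      ∀ c : Finset α → (α → ℝ) → ℕ, IsConstraintSystem U k c → WeaklyFragileSystem U k c →
      ∀ ε : ℝ, 0 < ε → ε ≤ ε₀ →
      ∀ (π σ : α → ℝ), IsRankingOn U π → IsOrderingOn U σ →
      (∀ x ∈ U, |π x - σ x| ≤ D * ε * (m : ℝ)) →
        costW U (fun x y => wbar U k c σ x y) π ≤
          (1 + C' * ε) * (k.choose 2 : ℝ) * (cost U k c π : ℝ) := by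
  set κ : ℝ := 1 / (10 * 3 ^ (k - 1)) with hκ
  set a : ℝ := 12 * D * (2 ^ (k - 2) * (k - 2).factorial) with ha
  have hκ0 : 0 < κ := by positivity
  have ha0 : 0 < a := by positivity
  refine ⟨2 * a / κ, 6 * k ^ 2 + 10, κ / (2 * a), by positivity, ?_⟩
  intro α U m hUm hm c hc hf ε hε hεle π σ hπ hσ hπσ
  have hm2k : 2 * k ≤ m := by nlinarith
  have hm0 : (m : ℝ) ≠ 0 := by exact_mod_cast (by omega : m ≠ 0)
  set N : ℝ := ((U.card - 2).choose (k - 2) : ℝ) with hN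
  have hN0 : 0 ≤ N := by positivity
  have haε : 2 * (a * ε) ≤ κ := by
    rw [le_div_iff₀ (by positivity)] at hεle
    linarith
  have hpair : ∀ p ∈ (U ×ˢ U).filter (fun p => π p.2 < π p.1), wbar U k c σ p.1 p.2 ≤
      (1 + 2 * a / κ * ε) *
        ((U.powersetCard k).filter fun S => (p.1 ∈ S ∧ p.2 ∈ S) ∧ c S π = 1).card := by
    rintro ⟨x, y⟩ hp
    simp only [Finset.mem_filter, Finset.mem_product] at hp ⊢
    obtain ⟨⟨hx, hy⟩, hyx⟩ := hp
    have hne : x ≠ y := by rintro rfl; exact lt_irrefl _ hyx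
    have hw := wgt_le hc hπ hσ hπσ hx hy hyx
    set P : ℝ := ((((U.powersetCard k).filter fun S =>
      (x ∈ S ∧ y ∈ S) ∧ c S π = 1).card : ℕ) : ℝ) with hP
    have hP0 : 0 ≤ P := by positivity
    have herr : 12 * (D * ε * m) * ((U.card : ℝ) ^ k / (U.card : ℝ) ^ 3) ≤ a * ε * N := by
      have h := pow_div_sq_le_mul_choose hk hm2k
      rw [← hUm, ← hN] at h
      rw [hUm] at h ⊢
      calc 12 * (D * ε * m) * ((m : ℝ) ^ k / (m : ℝ) ^ 3)
          = 12 * D * ε * ((m : ℝ) ^ k / (m : ℝ) ^ 2) := by field_simp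
        _ ≤ 12 * D * ε * (2 ^ (k - 2) * (k - 2).factorial * N) := by gcongr
        _ = a * ε * N := by rw [ha]; ring
    have hfrag : 2 * (κ * N) ≤ wgt U k c σ x y + wgt U k c σ y x := by
      obtain ⟨r, hr, hle⟩ := choose_le_wgt_add_wgt hk hc hf hσ hx hy hne
      have hjr : 2 * (k - 2) ^ 2 + 1 ≤ r := by
        have : (k - 2) ^ 2 ≤ k ^ 2 := Nat.pow_le_pow_left (Nat.sub_le _ _) 2
        omega
      have h := choose_le_mul_choose_of_le_three_mul hr hjr
      have hle' : (r.choose (k - 2) : ℝ) ≤ wgt U k c σ x y + wgt U k c σ y x := by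
        exact_mod_cast hle
      refine le_trans ?_ hle'
      have h3 : (3 : ℝ) ^ (k - 1) = 3 ^ (k - 2) * 3 := by
        rw [← pow_succ]; congr 1; omega
      rw [hκ, h3, one_div_mul_eq_div, ← mul_div_assoc, div_le_iff₀ (by positivity)]
      linarith
    have hwbar : wbar U k c σ x y = wgt U k c σ x y -
        min (κ * N) (min (wgt U k c σ x y : ℝ) (wgt U k c σ y x : ℝ)) := rfl
    rw [hwbar]
    have hcoef : 0 ≤ 2 * a / κ * ε := by positivity
    rcases le_or_gt (wgt U k c σ x y : ℝ) (κ * N) with hsmall | hbig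
    · rw [min_eq_left (by linarith : (wgt U k c σ x y : ℝ) ≤ wgt U k c σ y x),
        min_eq_right hsmall, sub_self]
      positivity
    · have hmin : 0 ≤ min (κ * N) (min (wgt U k c σ x y : ℝ) (wgt U k c σ y x : ℝ)) := by
        positivity
      have hNP : κ * N ≤ 2 * P := by nlinarith
      have : a * ε * N ≤ 2 * a / κ * ε * P := by
        calc a * ε * N = a / κ * ε * (κ * N) := by field_simp
          _ ≤ a / κ * ε * (2 * P) := by gcongr
          _ = 2 * a / κ * ε * P := by ring
      linarith
  calc costW U (fun x y => wbar U k c σ x y) π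
      = ∑ p ∈ (U ×ˢ U).filter (fun p => π p.2 < π p.1), wbar U k c σ p.1 p.2 := by
        rw [costW, Finset.sum_filter, Finset.sum_product]
    _ ≤ (1 + 2 * a / κ * ε) * ∑ p ∈ (U ×ˢ U).filter (fun p => π p.2 < π p.1),
        (((U.powersetCard k).filter fun S =>
          (p.1 ∈ S ∧ p.2 ∈ S) ∧ c S π = 1).card : ℝ) := by
        rw [Finset.mul_sum]
        exact Finset.sum_le_sum hpair
    _ ≤ (1 + 2 * a / κ * ε) * (k.choose 2 * cost U k c π) := by
        gcongr
        exact_mod_cast sum_card_le_choose_mul_cost U k c π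
    _ = (1 + 2 * a / κ * ε) * (k.choose 2 : ℝ) * (cost U k c π : ℝ) := by ring
end

section
/- Let U be a finite set, w a nonnegative weight function on ordered pairs of distinct elements of U, and α > 0 such that w_{uv} + w_{vu} ≥ α for all distinct u, v ∈ U. Then for all rankings π, π' of U: d(π, π') ≤ ( C^w(π) + C^w(π') ) / α. -/
open scoped Classical

universe u

/-- if `w` is a nonnegative FAS instance on `U` with
`w_{uv} + w_{vu} ≥ a > 0` for all distinct `u, v ∈ U`, then for all rankings `π, π'` of `U`,
`d(π,π') ≤ (C^w(π) + C^w(π'))/a`. -/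
theorem kendall_le_sum_costW_div {α : Type u} (U : Finset α) (w : α → α → ℝ)
    (hw : ∀ r ∈ U, ∀ s ∈ U, r ≠ s → 0 ≤ w r s)
    (a : ℝ) (ha : 0 < a) (hab : ∀ r ∈ U, ∀ s ∈ U, r ≠ s → a ≤ w r s + w s r)
    (π π' : α → ℝ) (hπ : IsRankingOn U π) (hπ' : IsRankingOn U π') :
    (kendall U π π' : ℝ) ≤ (costW U w π + costW U w π') / a := by
  rw [le_div_iff₀ ha]
  have hπ_cost : costW U w π = ∑ x ∈ U, ∑ y ∈ U, if π x < π y then w y x else 0 :=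
    Finset.sum_comm
  have h_kendall : (kendall U π π' : ℝ) * a =
      ∑ x ∈ U, ∑ y ∈ U, if π x < π y ∧ π' y < π' x then a else 0 := by
    rw [← Finset.sum_product', ← Finset.sum_filter, Finset.sum_const, nsmul_eq_mul, kendall]
  rw [h_kendall, hπ_cost, costW, ← Finset.sum_add_distrib]
  refine Finset.sum_le_sum fun x hx => ?_
  rw [← Finset.sum_add_distrib]
  refine Finset.sum_le_sum fun y hy => ?_
  by_cases hxy : x = y
  · simp [hxy]
  · have h₁ := hw x hx y hy hxy
    have h₂ := hw y hy x hx (Ne.symm hxy)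
    have h₃ := hab x hx y hy hxy
    split_ifs <;> grind
end
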